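/- Let u be a solution of the defocusing cubic NLS on [0,T] × ℝ², s ∈ (0,1), N ≥ 1, and let a : ℝ² × ℝ² → ℝ be continuously differentiable with |∇a| ≤ A everywhere. Set 𝒩(t,x) := |u(t,x)|²u(t,x) and W := I_N𝒩 − |I_N u|² I_N u. Then there is an absolute constant C such that | ∫₀^T ∫_{ℝ²×ℝ²} ∇a(x₁,x₂) · { Ñ_bad(t,·,·), I_N u(t,x₁) I_N u(t,x₂) }_p (x₁,x₂) dx₁ dx₂ dt | ≤ C A ( ‖W‖_{L¹_{[0,T]}L²_x} ‖∇ I_N u‖_{L^∞_{[0,T]}L²_x} + ‖∇_x W‖_{L¹_{[0,T]}L²_x} ‖I_N u‖_{L^∞_{[0,T]}L²_x} ) ‖I_N u‖_{L^∞_{[0,T]}L²_x}². -/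

import Mathlib

open MeasureTheory Real Complex
open scoped FourierTransform ENNReal ContDiff

noncomputable section

/-- The `j`-th partial derivative of a function on `EuclideanSpace ℝ (Fin n)`. -/
def pd {n : ℕ} {F : Type*} [NormedAddCommGroup F] [NormedSpace ℝ F]
    (j : Fin n) (f : EuclideanSpace ℝ (Fin n) → F) (x : EuclideanSpace ℝ (Fin n)) : F :=
  fderiv ℝ f x (EuclideanSpace.single j 1)

/-- The Laplacian. -/
def lap {n : ℕ} {F : Type*} [NormedAddCommGroup F] [NormedSpace ℝ F]
    (f : EuclideanSpace ℝ (Fin n) → F) (x : EuclideanSpace ℝ (Fin n)) : F :=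
  ∑ j, pd j (pd j f) x

/-- `f` coincides with a (complex-valued) Schwartz function. -/
def IsSchwartz {n : ℕ} (f : EuclideanSpace ℝ (Fin n) → ℂ) : Prop :=
  ∃ g : SchwartzMap (EuclideanSpace ℝ (Fin n)) ℂ, ⇑g = f

/-- `f` coincides with a (real-valued) Schwartz function. -/
def IsSchwartzR {n : ℕ} (f : EuclideanSpace ℝ (Fin n) → ℝ) : Prop :=
  ∃ g : SchwartzMap (EuclideanSpace ℝ (Fin n)) ℝ, ⇑g = f

/-- A (smooth, spatially Schwartz) solution of the defocusing cubic NLS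
`i ∂ₜ u + Δ u = |u|² u` on `[0,T] × ℝⁿ`. -/
def IsNLSSolution (n : ℕ) (T : ℝ) (u : ℝ → EuclideanSpace ℝ (Fin n) → ℂ) : Prop :=
  ContDiff ℝ ∞ (Function.uncurry u) ∧
  (∀ t ∈ Set.Icc (0:ℝ) T, IsSchwartz (u t)) ∧
  (∀ t ∈ Set.Icc (0:ℝ) T, ∀ x, Complex.I * deriv (fun s => u s x) t + lap (u t) x
      = (‖u t x‖ : ℂ)^2 * u t x)

/-- Inhomogeneous Sobolev norm via the Fourier transform. -/
def HsNorm {n : ℕ} (σ : ℝ) (f : EuclideanSpace ℝ (Fin n) → ℂ) : ℝ :=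
  (∫ ξ, (1 + ‖ξ‖) ^ (2 * σ) * ‖𝓕 f ξ‖ ^ 2) ^ ((1:ℝ)/2)

/-- Homogeneous Sobolev norm via the Fourier transform. -/
def HdotNorm {n : ℕ} (σ : ℝ) (f : EuclideanSpace ℝ (Fin n) → ℂ) : ℝ :=
  (∫ ξ, ‖ξ‖ ^ (2 * σ) * ‖𝓕 f ξ‖ ^ 2) ^ ((1:ℝ)/2)

/-- The Fourier multiplier operator with (real) symbol `m`. -/
def fourierMult {n : ℕ} (m : EuclideanSpace ℝ (Fin n) → ℝ) (f : EuclideanSpace ℝ (Fin n) → ℂ) :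
    EuclideanSpace ℝ (Fin n) → ℂ :=
  𝓕⁻ (fun ξ => (m ξ : ℂ) * 𝓕 f ξ)

/-- The standing hypotheses on the radial profile `φ` of the symbol of the smoothing
operator `I = I_N`, with derivative-bound constants `Ck` (independent of `N`). -/
structure IMultiplier (s N : ℝ) (Ck : ℕ → ℝ) (φ : ℝ → ℝ) : Prop where
  contDiff : ContDiffOn ℝ ∞ φ (Set.Ioi 0)
  pos : ∀ r > (0:ℝ), 0 < φ r
  le_one : ∀ r > (0:ℝ), φ r ≤ 1
  anti : AntitoneOn φ (Set.Ioi 0)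
  eq_one : ∀ r : ℝ, 0 < r → r ≤ N → φ r = 1
  eq_pow : ∀ r : ℝ, 2 * N ≤ r → φ r = (r / N) ^ (s - 1)
  mono_mul : MonotoneOn (fun r => r * φ r) (Set.Ioi 0)
  deriv_bound : ∀ k : ℕ, 1 ≤ k → ∀ r > (0:ℝ), |iteratedDeriv k φ r| ≤ Ck k * φ r * r ^ (-(k:ℝ))

/-- The smoothing operator `I = I_N`, a Fourier multiplier with symbol `φ (|ξ|)`. -/
def Iop {n : ℕ} (φ : ℝ → ℝ) (f : EuclideanSpace ℝ (Fin n) → ℂ) : EuclideanSpace ℝ (Fin n) → ℂ :=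
  fourierMult (fun ξ => φ ‖ξ‖) f

/-- The operator `⟨D⟩ I_N`, a Fourier multiplier with symbol `(1 + |ξ|) φ (|ξ|)`. -/
def DIop {n : ℕ} (φ : ℝ → ℝ) (f : EuclideanSpace ℝ (Fin n) → ℂ) : EuclideanSpace ℝ (Fin n) → ℂ :=
  fourierMult (fun ξ => (1 + ‖ξ‖) * φ ‖ξ‖) f

/-- Mixed space-time norm `‖v‖_{L^q_{[0,T]} L^r_x}` (with values in `ℝ≥0∞`). -/
def mixNorm {α : Type*} [MeasureSpace α] {F : Type*} [NormedAddCommGroup F]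
    (T : ℝ) (q r : ℝ≥0∞) (v : ℝ → α → F) : ℝ≥0∞ :=
  eLpNorm (fun t => (eLpNorm (v t) r volume).toReal) q (volume.restrict (Set.Ioc 0 T))

/-- An admissible pair in `ℝ²`: `1/q + 1/r = 1/2` and `2 < q ≤ ∞`. -/
def Admissible (q r : ℝ≥0∞) : Prop := 1/q + 1/r = 1/2 ∧ 2 < q

/-- The `L²` norm. -/
def L2Norm {n : ℕ} (f : EuclideanSpace ℝ (Fin n) → ℂ) : ℝ :=
  (∫ x, ‖f x‖ ^ 2) ^ ((1:ℝ)/2)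

/-- The `L²` norm of the (spatial) gradient. -/
def gradL2Norm {n : ℕ} (f : EuclideanSpace ℝ (Fin n) → ℂ) : ℝ :=
  (∫ x, ∑ j, ‖pd j f x‖ ^ 2) ^ ((1:ℝ)/2)

/-- Space-time `L⁴_{[0,T]} L⁴_x` norm (real-valued). -/
def L4L4Norm {n : ℕ} (T : ℝ) (v : ℝ → EuclideanSpace ℝ (Fin n) → ℂ) : ℝ :=
  (∫ t in Set.Ioc (0:ℝ) T, ∫ x, ‖v t x‖ ^ 4) ^ ((1:ℝ)/4)

/-- The modified energy `E(v) = ½∫|∇v|² + ¼∫|v|⁴`. -/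
def energy {n : ℕ} (v : EuclideanSpace ℝ (Fin n) → ℂ) : ℝ :=
  (1/2) * (∫ x, ∑ j, ‖pd j v x‖ ^ 2) + (1/4) * ∫ x, ‖v x‖ ^ 4

/-- The Morawetz action `M_a(t) = 2 ∫ ∇a · Im (ū ∇u) dx`. -/
def morAction {n : ℕ} (a : EuclideanSpace ℝ (Fin n) → ℝ)
    (u : ℝ → EuclideanSpace ℝ (Fin n) → ℂ) (t : ℝ) : ℝ :=
  2 * ∫ x, ∑ j, pd j a x * ((starRingEnd ℂ) (u t x) * pd j (u t) x).im

/-- All derivatives of `a` grow at most polynomially. -/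
def PolyGrowth {n : ℕ} (a : EuclideanSpace ℝ (Fin n) → ℝ) : Prop :=
  ∀ k : ℕ, ∃ C d : ℝ, ∀ x, ‖iteratedFDeriv ℝ k a x‖ ≤ C * (1 + ‖x‖) ^ d

/-- The cubic nonlinearity `|u|²u`. -/
def cubicN {n : ℕ} (u : ℝ → EuclideanSpace ℝ (Fin n) → ℂ) (t : ℝ)
    (x : EuclideanSpace ℝ (Fin n)) : ℂ :=
  ((‖u t x‖ ^ 2 : ℝ) : ℂ) * u t x

/-- The commutator `W = I_N(|u|²u) - |I_N u|² I_N u`. -/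
def Wcomm {n : ℕ} (φ : ℝ → ℝ) (u : ℝ → EuclideanSpace ℝ (Fin n) → ℂ) (t : ℝ)
    (x : EuclideanSpace ℝ (Fin n)) : ℂ :=
  Iop φ (cubicN u t) x - ((‖Iop φ (u t) x‖ ^ 2 : ℝ) : ℂ) * Iop φ (u t) x

/-- The bad part `Ñ_bad` of the nonlinearity on `ℝ² × ℝ²`. -/
def Nbad (φ : ℝ → ℝ) (u : ℝ → EuclideanSpace ℝ (Fin 2) → ℂ) (t : ℝ)
    (p : EuclideanSpace ℝ (Fin 2) × EuclideanSpace ℝ (Fin 2)) : ℂ :=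
  Wcomm φ u t p.1 * Iop φ (u t) p.2 + Wcomm φ u t p.2 * Iop φ (u t) p.1

/-- The tensor product `I_N u (t,x₁) · I_N u (t,x₂)`. -/
def tensIu (φ : ℝ → ℝ) (u : ℝ → EuclideanSpace ℝ (Fin 2) → ℂ) (t : ℝ)
    (p : EuclideanSpace ℝ (Fin 2) × EuclideanSpace ℝ (Fin 2)) : ℂ :=
  Iop φ (u t) p.1 * Iop φ (u t) p.2

/-- The component of the momentum bracket `{F, G}_p` in the direction `v`. -/
def bracketDir (F G : EuclideanSpace ℝ (Fin 2) × EuclideanSpace ℝ (Fin 2) → ℂ)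
    (p v : EuclideanSpace ℝ (Fin 2) × EuclideanSpace ℝ (Fin 2)) : ℝ :=
  (F p * (starRingEnd ℂ) (fderiv ℝ G p v) - G p * (starRingEnd ℂ) (fderiv ℝ F p v)).re

/-- The error density `∇a · { Ñ_bad , I_N u ⊗ I_N u }_p (x₁, x₂)`. -/
def errDensity (a : EuclideanSpace ℝ (Fin 2) × EuclideanSpace ℝ (Fin 2) → ℝ)
    (φ : ℝ → ℝ) (u : ℝ → EuclideanSpace ℝ (Fin 2) → ℂ) (t : ℝ)
    (p : EuclideanSpace ℝ (Fin 2) × EuclideanSpace ℝ (Fin 2)) : ℝ :=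
  (∑ j : Fin 2, fderiv ℝ a p (EuclideanSpace.single j 1, 0) *
      bracketDir (Nbad φ u t) (tensIu φ u t) p (EuclideanSpace.single j 1, 0))
  + ∑ j : Fin 2, fderiv ℝ a p (0, EuclideanSpace.single j 1) *
      bracketDir (Nbad φ u t) (tensIu φ u t) p (0, EuclideanSpace.single j 1)

/-- The Euclidean plane. -/
abbrev Plane := EuclideanSpace ℝ (Fin 2)

/-- The Fourier transform of `f` is bounded by `M (1 + |ξ|)⁻⁶`. -/
def FourierDecay (M : ℝ) (f : Plane → ℂ) : Prop :=
  ∀ ξ, (1 + ‖ξ‖) ^ 6 * ‖𝓕 f ξ‖ ≤ M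

/-- The Wiener algebra norm, i.e. the `L¹` norm of the Fourier transform. -/
def wienerNorm (f : Plane → ℂ) : ℝ := ∫ ξ, ‖𝓕 f ξ‖

theorem integrable_inv_one_add_norm_pow {k : ℕ} (hk : 3 ≤ k) :
    Integrable (fun ξ : Plane => ((1 + ‖ξ‖) ^ k)⁻¹) := by
  have h := integrable_one_add_norm (E := Plane) (μ := volume) (r := (k : ℝ))
    (by simp; exact_mod_cast hk)
  refine h.congr (Filter.Eventually.of_forall fun ξ => ?_)
  simp only
  rw [Real.rpow_neg (by positivity), Real.rpow_natCast]

theorem wienerNorm_nonneg (f : Plane → ℂ) : 0 ≤ wienerNorm f :=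
  integral_nonneg fun _ => norm_nonneg _

theorem FourierDecay.norm_le {M : ℝ} {f : Plane → ℂ} (h : FourierDecay M f) (ξ : Plane) :
    ‖𝓕 f ξ‖ ≤ M * ((1 + ‖ξ‖) ^ 6)⁻¹ := by
  have := h ξ
  rw [← div_eq_mul_inv, le_div_iff₀ (by positivity)]
  linarith

theorem FourierDecay.nonneg {M : ℝ} {f : Plane → ℂ} (h : FourierDecay M f) : 0 ≤ M :=
  le_trans (by positivity) (h 0)

theorem FourierDecay.norm_le_const {M : ℝ} {f : Plane → ℂ} (h : FourierDecay M f) (ξ : Plane) :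
    ‖𝓕 f ξ‖ ≤ M := by
  refine le_trans ?_ (h ξ)
  have : 1 ≤ (1 + ‖ξ‖) ^ 6 := one_le_pow₀ (by linarith [norm_nonneg ξ])
  nlinarith [norm_nonneg (𝓕 f ξ)]

theorem FourierDecay.mono {M M' : ℝ} {f : Plane → ℂ} (h : FourierDecay M f) (hM : M ≤ M') :
    FourierDecay M' f := fun ξ => (h ξ).trans hM

theorem FourierDecay.wienerNorm_le {M : ℝ} {f : Plane → ℂ} (h : FourierDecay M f) :
    wienerNorm f ≤ M * ∫ ξ : Plane, ((1 + ‖ξ‖) ^ 6)⁻¹ := by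
  rw [← integral_const_mul]
  exact integral_mono_of_nonneg (Filter.Eventually.of_forall fun _ => norm_nonneg _)
    ((integrable_inv_one_add_norm_pow (by norm_num)).const_mul M)
    (Filter.Eventually.of_forall h.norm_le)

namespace SchwartzMap

theorem exists_fourierDecay (f : 𝓢(Plane, ℂ)) : ∃ M, FourierDecay M f := by
  refine ⟨2 ^ 6 * ((Finset.Iic ((6 : ℕ), (0 : ℕ))).sup
    fun m => SchwartzMap.seminorm ℝ m.1 m.2) (𝓕 f), fun ξ => ?_⟩
  have h := SchwartzMap.one_add_le_sup_seminorm_apply (𝕜 := ℝ) (m := (6, 0)) (k := 6) (n := 0)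
    le_rfl le_rfl (𝓕 f) ξ
  rwa [norm_iteratedFDeriv_zero] at h

theorem fourier_continuous (f : 𝓢(Plane, ℂ)) : Continuous (𝓕 (f : Plane → ℂ)) :=
  (𝓕 f).continuous

theorem fourier_integrable (f : 𝓢(Plane, ℂ)) : Integrable (𝓕 (f : Plane → ℂ)) :=
  (𝓕 f).integrable

theorem norm_le_wienerNorm (f : 𝓢(Plane, ℂ)) (x : Plane) : ‖f x‖ ≤ wienerNorm f := by
  have h : f x = 𝓕⁻ (𝓕 (f : Plane → ℂ)) x := by
    rw [← fourier_coe, ← fourierInv_coe]; simp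
  rw [h, Real.fourierInv_eq]
  refine (norm_integral_le_integral_norm _).trans (le_of_eq ?_)
  simp [wienerNorm]

/-- Pointwise product of Schwartz functions. -/
def mulS (f g : 𝓢(Plane, ℂ)) : 𝓢(Plane, ℂ) := pairing (ContinuousLinearMap.mul ℂ ℂ) f g

/-- Complex conjugate of a Schwartz function. -/
def conjS (f : 𝓢(Plane, ℂ)) : 𝓢(Plane, ℂ) :=
  postcompCLM (𝕜 := ℝ) (Complex.conjCLE : ℂ →L[ℝ] ℂ) f

/-- The cubic nonlinearity applied to a Schwartz function. -/
def cubicS (f : 𝓢(Plane, ℂ)) : 𝓢(Plane, ℂ) := mulS (mulS f (conjS f)) f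

theorem mulS_apply (f g : 𝓢(Plane, ℂ)) (x : Plane) : mulS f g x = f x * g x := by
  simp [mulS]

theorem conjS_apply (f : 𝓢(Plane, ℂ)) (x : Plane) : conjS f x = (starRingEnd ℂ) (f x) := by
  simp [conjS]

theorem cubicS_apply (f : 𝓢(Plane, ℂ)) (x : Plane) :
    cubicS f x = ((‖f x‖ ^ 2 : ℝ) : ℂ) * f x := by
  rw [cubicS, mulS_apply, mulS_apply, conjS_apply, Complex.mul_conj, Complex.normSq_eq_norm_sq]

theorem fourier_mulS (f g : 𝓢(Plane, ℂ)) (ξ : Plane) :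
    𝓕 (mulS f g : Plane → ℂ) ξ = ∫ η, 𝓕 (f : Plane → ℂ) η * 𝓕 (g : Plane → ℂ) (ξ - η) := by
  have hG : Integrable (fun x => Complex.exp ((-2 * π * inner ℝ x ξ : ℝ) * I) * g x) := by
    refine g.integrable.bdd_mul (c := 1) (by fun_prop) (Filter.Eventually.of_forall fun x => ?_)
    rw [Complex.norm_exp_ofReal_mul_I]
  set G : Plane → ℂ := fun x => Complex.exp ((-2 * π * inner ℝ x ξ : ℝ) * I) * g x with hGdef
  have h1 : ∀ η, 𝓕⁻ G η = 𝓕 (g : Plane → ℂ) (ξ - η) := by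
    intro η
    rw [Real.fourierInv_eq', Real.fourier_eq']
    congr 1
    ext x
    simp only [smul_eq_mul, hGdef]
    rw [← mul_assoc, ← Complex.exp_add]
    congr 2
    rw [inner_sub_right]
    push_cast
    ring
  have h2 : ∫ x, 𝓕⁻ (𝓕 (f : Plane → ℂ)) x • G x = ∫ η, 𝓕 (f : Plane → ℂ) η • 𝓕⁻ G η := by
    have h := VectorFourier.integral_fourierIntegral_smul_eq_flip (μ := volume) (ν := volume)
      (L := -innerₗ Plane) (e := 𝐞) Real.continuous_fourierChar
      (by exact continuous_inner.neg) f.fourier_integrable hG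
    have hflip : (-innerₗ Plane).flip = -innerₗ Plane := by
      ext x y; simp [real_inner_comm]
    rw [hflip] at h
    exact h
  have h3 : ∀ x, 𝓕⁻ (𝓕 (f : Plane → ℂ)) x = f x := by
    intro x
    rw [← fourier_coe, ← fourierInv_coe]; simp
  simp only [h1, h3, smul_eq_mul] at h2
  rw [← h2, Real.fourier_eq']
  refine integral_congr_ae (Filter.Eventually.of_forall fun x => ?_)
  simp only [hGdef, smul_eq_mul, mulS_apply]
  ring

theorem fourier_conjS (f : 𝓢(Plane, ℂ)) (ξ : Plane) :
    𝓕 (conjS f : Plane → ℂ) ξ = (starRingEnd ℂ) (𝓕 (f : Plane → ℂ) (-ξ)) := by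
  rw [Real.fourier_eq', Real.fourier_eq', ← integral_conj]
  refine integral_congr_ae (Filter.Eventually.of_forall fun x => ?_)
  simp only [smul_eq_mul, conjS_apply, map_mul, ← Complex.exp_conj, Complex.conj_I,
    Complex.conj_ofReal, inner_neg_right]
  push_cast
  ring_nf

theorem wienerNorm_conjS (f : 𝓢(Plane, ℂ)) :
    wienerNorm (conjS f : Plane → ℂ) = wienerNorm (f : Plane → ℂ) := by
  unfold wienerNorm
  simp only [fourier_conjS, RCLike.norm_conj]
  exact integral_neg_eq_self (fun ξ => ‖𝓕 (f : Plane → ℂ) ξ‖) volume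

theorem fourierDecay_conjS {M : ℝ} {f : 𝓢(Plane, ℂ)} (h : FourierDecay M f) :
    FourierDecay M (conjS f) := by
  intro ξ
  rw [fourier_conjS, RCLike.norm_conj]
  simpa using h (-ξ)

theorem norm_fourier_mulS_le (f g : 𝓢(Plane, ℂ)) (ξ : Plane) :
    ‖𝓕 (mulS f g : Plane → ℂ) ξ‖
      ≤ ∫ η, ‖𝓕 (f : Plane → ℂ) η‖ * ‖𝓕 (g : Plane → ℂ) (ξ - η)‖ := by
  rw [fourier_mulS]
  refine (norm_integral_le_integral_norm _).trans (le_of_eq ?_)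
  simp

theorem wienerNorm_mulS_le (f g : 𝓢(Plane, ℂ)) :
    wienerNorm (mulS f g : Plane → ℂ) ≤ wienerNorm f * wienerNorm g := by
  have hf := f.fourier_integrable.norm
  have hg := g.fourier_integrable.norm
  have hfg := Integrable.convolution_integrand (ContinuousLinearMap.mul ℝ ℝ) hf hg
    (μ := volume) (ν := volume)
  simp only [ContinuousLinearMap.mul_apply'] at hfg
  calc wienerNorm (mulS f g : Plane → ℂ)
      ≤ ∫ ξ, ∫ η, ‖𝓕 (f : Plane → ℂ) η‖ * ‖𝓕 (g : Plane → ℂ) (ξ - η)‖ := by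
        refine integral_mono (mulS f g).fourier_integrable.norm hfg.integral_prod_left
          (norm_fourier_mulS_le f g)
    _ = ∫ η, ∫ ξ, ‖𝓕 (f : Plane → ℂ) η‖ * ‖𝓕 (g : Plane → ℂ) (ξ - η)‖ :=
        integral_integral_swap hfg
    _ = wienerNorm f * wienerNorm g := by
        simp only [integral_const_mul]
        simp only [integral_sub_right_eq_self (fun ξ => ‖𝓕 (g : Plane → ℂ) ξ‖)]
        rw [integral_mul_const]
        rfl

theorem integrable_mul_fourier_sub (f g : 𝓢(Plane, ℂ)) (ξ : Plane) :
    Integrable (fun η => ‖𝓕 (f : Plane → ℂ) η‖ * ‖𝓕 (g : Plane → ℂ) (ξ - η)‖) := by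
  obtain ⟨M, hM⟩ := g.exists_fourierDecay
  refine f.fourier_integrable.norm.mul_bdd (c := M) ?_ (Filter.Eventually.of_forall fun η => ?_)
  · exact (g.fourier_continuous.comp
      (by fun_prop : Continuous fun η : Plane => ξ - η)).norm.aestronglyMeasurable
  · simpa using hM.norm_le_const (ξ - η)

theorem fourierDecay_mulS {M M' : ℝ} {f g : 𝓢(Plane, ℂ)} (hf : FourierDecay M f)
    (hg : FourierDecay M' g) :
    FourierDecay (32 * (M * wienerNorm g + wienerNorm f * M')) (mulS f g) := by
  intro ξ
  have hi1 : Integrable (fun η => 32 * (M * ‖𝓕 (g : Plane → ℂ) (ξ - η)‖)) :=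
    ((g.fourier_integrable.norm.comp_sub_left ξ).const_mul M).const_mul 32
  have hi2 : Integrable (fun η => 32 * (M' * ‖𝓕 (f : Plane → ℂ) η‖)) :=
    (f.fourier_integrable.norm.const_mul M').const_mul 32
  calc (1 + ‖ξ‖) ^ 6 * ‖𝓕 (mulS f g : Plane → ℂ) ξ‖
      ≤ (1 + ‖ξ‖) ^ 6 * ∫ η, ‖𝓕 (f : Plane → ℂ) η‖ * ‖𝓕 (g : Plane → ℂ) (ξ - η)‖ := by
        gcongr; exact norm_fourier_mulS_le f g ξ
    _ = ∫ η, (1 + ‖ξ‖) ^ 6 * (‖𝓕 (f : Plane → ℂ) η‖ * ‖𝓕 (g : Plane → ℂ) (ξ - η)‖) := by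
        rw [integral_const_mul]
    _ ≤ ∫ η, (32 * (M * ‖𝓕 (g : Plane → ℂ) (ξ - η)‖) + 32 * (M' * ‖𝓕 (f : Plane → ℂ) η‖)) := by
        refine integral_mono ((integrable_mul_fourier_sub f g ξ).const_mul _) (hi1.add hi2) ?_
        intro η
        simp only
        have h1 := hf η
        have h2 := hg (ξ - η)
        set a := ‖𝓕 (f : Plane → ℂ) η‖
        set b := ‖𝓕 (g : Plane → ℂ) (ξ - η)‖
        have ha : 0 ≤ a := norm_nonneg _
        have hb : 0 ≤ b := norm_nonneg _
        have hx : (1 + ‖ξ‖) ^ 6 ≤ 32 * ((1 + ‖η‖) ^ 6 + (1 + ‖ξ - η‖) ^ 6) := by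
          have h3 : ‖ξ‖ ≤ ‖η‖ + ‖ξ - η‖ := by
            simpa using norm_add_le η (ξ - η)
          have h4 : (1 + ‖ξ‖) ^ 6 ≤ ((1 + ‖η‖) + (1 + ‖ξ - η‖)) ^ 6 := by
            exact pow_le_pow_left₀ (by positivity) (by linarith) 6
          refine h4.trans ?_
          have := add_pow_le (a := 1 + ‖η‖) (b := 1 + ‖ξ - η‖) (by positivity) (by positivity) 6
          norm_num at this
          linarith
        calc (1 + ‖ξ‖) ^ 6 * (a * b)
            ≤ 32 * ((1 + ‖η‖) ^ 6 + (1 + ‖ξ - η‖) ^ 6) * (a * b) := by gcongr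
          _ = 32 * (((1 + ‖η‖) ^ 6 * a) * b) + 32 * (((1 + ‖ξ - η‖) ^ 6 * b) * a) := by ring
          _ ≤ _ := by gcongr
    _ = 32 * (M * wienerNorm g + wienerNorm f * M') := by
        rw [integral_add hi1 hi2]
        simp only [integral_const_mul]
        rw [integral_sub_left_eq_self (fun η => ‖𝓕 (g : Plane → ℂ) η‖) volume ξ]
        simp only [wienerNorm]
        ring

theorem fourierDecay_cubicS {M : ℝ} {f : 𝓢(Plane, ℂ)} (h : FourierDecay M f) :
    FourierDecay (2080 * wienerNorm f ^ 2 * M) (cubicS f) := by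
  have h1 := fourierDecay_mulS h (fourierDecay_conjS h)
  refine (fourierDecay_mulS h1 h).mono ?_
  have := wienerNorm_mulS_le f (conjS f)
  rw [wienerNorm_conjS] at this ⊢
  have hw := wienerNorm_nonneg f
  have hM := h.nonneg
  nlinarith [mul_le_mul_of_nonneg_right this hM]

open LineDeriv in
/-- The `j`-th partial derivative of a Schwartz function. -/
def pdS (j : Fin 2) (f : 𝓢(Plane, ℂ)) : 𝓢(Plane, ℂ) := ∂_{(EuclideanSpace.single j 1 : Plane)} f

/-- The Laplacian of a Schwartz function. -/
def lapS (f : 𝓢(Plane, ℂ)) : 𝓢(Plane, ℂ) := ∑ j, pdS j (pdS j f)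

/-- The value of `∂ₜ u` prescribed by the equation. -/
def rhsS (f : 𝓢(Plane, ℂ)) : 𝓢(Plane, ℂ) := I • (lapS f - cubicS f)

theorem coe_pdS (j : Fin 2) (f : 𝓢(Plane, ℂ)) : ⇑(pdS j f) = pd j (f : Plane → ℂ) := by
  ext x
  rw [pdS, lineDerivOp_apply_eq_fderiv, pd]

theorem coe_lapS (f : 𝓢(Plane, ℂ)) : ⇑(lapS f) = lap (f : Plane → ℂ) := by
  ext x
  simp [lapS, lap, coe_pdS]

theorem rhsS_apply (f : 𝓢(Plane, ℂ)) (x : Plane) :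
    rhsS f x = I * (lapS f x - cubicS f x) := by
  simp [rhsS]

theorem fourier_pdS (j : Fin 2) (f : 𝓢(Plane, ℂ)) (ξ : Plane) :
    𝓕 (pdS j f : Plane → ℂ) ξ = 2 * π * I * ξ j * 𝓕 (f : Plane → ℂ) ξ := by
  have h := congrArg (fun g : 𝓢(Plane, ℂ) => g ξ)
    (fourier_lineDerivOp_eq f (EuclideanSpace.single j (1 : ℝ)))
  simp only [fourier_coe] at h
  rw [pdS, h]
  simp only [smul_apply]
  rw [smulLeftCLM_apply_apply (by fun_prop)]
  simp [fourier_coe, EuclideanSpace.inner_single_right]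
  ring

theorem norm_sq_eq_plane (ξ : Plane) : ‖ξ‖ ^ 2 = ξ 0 ^ 2 + ξ 1 ^ 2 := by
  rw [EuclideanSpace.norm_sq_eq]; simp

theorem fourier_lapS (f : 𝓢(Plane, ℂ)) (ξ : Plane) :
    𝓕 (lapS f : Plane → ℂ) ξ = -((4 * π ^ 2 * ‖ξ‖ ^ 2 : ℝ) : ℂ) * 𝓕 (f : Plane → ℂ) ξ := by
  have h : 𝓕 (lapS f) = ∑ j, 𝓕 (pdS j (pdS j f)) := by
    simp [lapS, FourierTransform.fourier_add]
  rw [← fourier_coe, h]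
  simp only [Fin.sum_univ_two, add_apply, fourier_coe, fourier_pdS]
  rw [norm_sq_eq_plane]
  push_cast
  linear_combination (4 * π ^ 2 * ((ξ 0 : ℂ) ^ 2 + ξ 1 ^ 2) * 𝓕 (f : Plane → ℂ) ξ) * Complex.I_sq

theorem fourier_rhsS (f : 𝓢(Plane, ℂ)) (ξ : Plane) :
    𝓕 (rhsS f : Plane → ℂ) ξ
      = -I * (((4 * π ^ 2 * ‖ξ‖ ^ 2 : ℝ) : ℂ) * 𝓕 (f : Plane → ℂ) ξ
          + 𝓕 (cubicS f : Plane → ℂ) ξ) := by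
  have h : 𝓕 (rhsS f) = I • (𝓕 (lapS f) - 𝓕 (cubicS f)) := by
    rw [rhsS, FourierTransform.fourier_smul, sub_eq_add_neg, FourierTransform.fourier_add,
      ← neg_one_smul ℂ (cubicS f), FourierTransform.fourier_smul, neg_one_smul, ← sub_eq_add_neg]
  rw [← fourier_coe, h]
  simp only [smul_apply, sub_apply, fourier_coe, fourier_lapS, smul_eq_mul]
  ring

theorem plancherel (f : 𝓢(Plane, ℂ)) :
    ∫ ξ, ‖𝓕 (f : Plane → ℂ) ξ‖ ^ 2 = ∫ x, ‖f x‖ ^ 2 :=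
  integral_norm_sq_fourier f

theorem plancherel_conj (f g : 𝓢(Plane, ℂ)) :
    ∫ ξ, (starRingEnd ℂ) (𝓕 (f : Plane → ℂ) ξ) * 𝓕 (g : Plane → ℂ) ξ
      = ∫ x, (starRingEnd ℂ) (f x) * g x := by
  have := integral_inner_fourier_fourier f g
  simp only [fourier_coe, RCLike.inner_apply] at this
  simpa only [mul_comm] using this

theorem integrable_norm_sq (f : 𝓢(Plane, ℂ)) : Integrable (fun x => ‖f x‖ ^ 2) :=
  (f.memLp 2).integrable_norm_pow (by norm_num)

theorem gradL2Norm_eq (f : 𝓢(Plane, ℂ)) :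
    gradL2Norm (f : Plane → ℂ)
      = (∫ ξ, 4 * π ^ 2 * ‖ξ‖ ^ 2 * ‖𝓕 (f : Plane → ℂ) ξ‖ ^ 2) ^ ((1:ℝ)/2) := by
  unfold gradL2Norm
  congr 1
  simp only [← coe_pdS]
  rw [integral_finsetSum _ fun j _ => integrable_norm_sq (pdS j f)]
  have h_int : ∀ j, Integrable (fun ξ => ‖𝓕 (pdS j f : Plane → ℂ) ξ‖ ^ 2) :=
    fun j => integrable_norm_sq (𝓕 (pdS j f))
  simp only [← plancherel]
  rw [← integral_finsetSum _ fun j _ => h_int j]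
  refine integral_congr_ae (Filter.Eventually.of_forall fun ξ => ?_)
  simp only [fourier_pdS, norm_mul, Fin.sum_univ_two, norm_sq_eq_plane]
  simp [mul_pow]
  ring

theorem L2Norm_eq (f : 𝓢(Plane, ℂ)) :
    L2Norm (f : Plane → ℂ) = (∫ ξ, ‖𝓕 (f : Plane → ℂ) ξ‖ ^ 2) ^ ((1:ℝ)/2) := by
  rw [L2Norm, plancherel]

/-- The integral of the weight `(1 + |ξ|)⁻⁴`. -/
def weightIntegral : ℝ := ∫ ξ : Plane, ((1 + ‖ξ‖) ^ 4)⁻¹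

theorem weightIntegral_nonneg : 0 ≤ weightIntegral := integral_nonneg fun _ => by positivity

theorem wienerNorm_le_of_decay {M : ℝ} {f : Plane → ℂ} (h : FourierDecay M f) :
    wienerNorm f ≤ M * weightIntegral := by
  refine h.wienerNorm_le.trans (mul_le_mul_of_nonneg_left ?_ h.nonneg)
  refine integral_mono (integrable_inv_one_add_norm_pow (by norm_num))
    (integrable_inv_one_add_norm_pow (by norm_num)) fun ξ => ?_
  simp only
  gcongr
  · linarith [norm_nonneg ξ]
  · norm_num

theorem wienerNorm_le_of_bound {C : ℝ} {f : 𝓢(Plane, ℂ)}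
    (h : ∀ ξ, ‖𝓕 (f : Plane → ℂ) ξ‖ ≤ C * ((1 + ‖ξ‖) ^ 4)⁻¹) :
    wienerNorm f ≤ C * weightIntegral := by
  rw [wienerNorm, weightIntegral, ← integral_const_mul]
  exact integral_mono f.fourier_integrable.norm
    ((integrable_inv_one_add_norm_pow (by norm_num)).const_mul C) h

/-- A constant controlling `∂ₜ u` in terms of the Fourier decay of `u`. -/
def rhsBound (M : ℝ) : ℝ := 4 * π ^ 2 * M + 2080 * (M * weightIntegral) ^ 2 * M

theorem norm_fourier_rhsS_le {M : ℝ} {f : 𝓢(Plane, ℂ)} (h : FourierDecay M f) (ξ : Plane) :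
    ‖𝓕 (rhsS f : Plane → ℂ) ξ‖ ≤ rhsBound M * ((1 + ‖ξ‖) ^ 4)⁻¹ := by
  have hM := h.nonneg
  have hw := wienerNorm_le_of_decay h
  have hN := ((fourierDecay_cubicS h).mono (M' := 2080 * (M * weightIntegral) ^ 2 * M) (by
    have := wienerNorm_nonneg f
    gcongr)) ξ
  have hf := h ξ
  rw [fourier_rhsS, norm_mul, norm_neg, Complex.norm_I, one_mul, ← div_eq_mul_inv,
    le_div_iff₀ (by positivity)]
  set a := ‖𝓕 (f : Plane → ℂ) ξ‖ with ha
  set b := ‖𝓕 (cubicS f : Plane → ℂ) ξ‖ with hb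
  have h1 : ‖((4 * π ^ 2 * ‖ξ‖ ^ 2 : ℝ) : ℂ) * 𝓕 (f : Plane → ℂ) ξ
      + 𝓕 (cubicS f : Plane → ℂ) ξ‖ ≤ 4 * π ^ 2 * (1 + ‖ξ‖) ^ 2 * a + (1 + ‖ξ‖) ^ 2 * b := by
    refine (norm_add_le _ _).trans ?_
    rw [norm_mul, Complex.norm_real, Real.norm_of_nonneg (by positivity)]
    have : ‖ξ‖ ^ 2 ≤ (1 + ‖ξ‖) ^ 2 := by gcongr; linarith
    have h1 : 1 ≤ (1 + ‖ξ‖) ^ 2 := one_le_pow₀ (by linarith [norm_nonneg ξ])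
    have : b ≤ (1 + ‖ξ‖) ^ 2 * b := le_mul_of_one_le_left (norm_nonneg _) h1
    gcongr
  calc _ ≤ (4 * π ^ 2 * (1 + ‖ξ‖) ^ 2 * a + (1 + ‖ξ‖) ^ 2 * b) * (1 + ‖ξ‖) ^ 4 := by gcongr
    _ = 4 * π ^ 2 * ((1 + ‖ξ‖) ^ 6 * a) + (1 + ‖ξ‖) ^ 6 * b := by ring
    _ ≤ _ := by unfold rhsBound; gcongr

theorem rhsBound_nonneg {M : ℝ} (hM : 0 ≤ M) : 0 ≤ rhsBound M := by
  unfold rhsBound; positivity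

theorem norm_rhsS_le {M : ℝ} {f : 𝓢(Plane, ℂ)} (h : FourierDecay M f) (x : Plane) :
    ‖rhsS f x‖ ≤ rhsBound M * weightIntegral :=
  (norm_le_wienerNorm _ x).trans (wienerNorm_le_of_bound (norm_fourier_rhsS_le h))

theorem norm_fourier_rhsS_le_const {M : ℝ} {f : 𝓢(Plane, ℂ)} (h : FourierDecay M f) (ξ : Plane) :
    ‖𝓕 (rhsS f : Plane → ℂ) ξ‖ ≤ rhsBound M := by
  refine (norm_fourier_rhsS_le h ξ).trans (mul_le_of_le_one_right (rhsBound_nonneg h.nonneg) ?_)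
  exact inv_le_one_of_one_le₀ (one_le_pow₀ (by linarith [norm_nonneg ξ]))

theorem norm_integral_gaussian_mul_le {D : ℝ} {f : 𝓢(Plane, ℂ)}
    (hD : ∀ η, ‖𝓕 (f : Plane → ℂ) η‖ ≤ D) {ε : ℝ} (hε : 0 < ε) (ξ : Plane) :
    ‖∫ x, (rexp (-ε * ‖x‖ ^ 2) : ℂ) * (cexp ((-2 * π * inner ℝ x ξ : ℝ) * I) * f x)‖ ≤ D := by
  have hε' : 0 < (ε : ℂ).re := by simpa using hε
  set G : Plane → ℂ := fun x => cexp (-ε * ‖x‖ ^ 2 + 2 * π * I * inner ℝ (-ξ) x) with hG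
  have hGint : Integrable G := GaussianFourier.integrable_cexp_neg_mul_sq_norm_add hε' _ _
  have h1 : ∀ η, ‖𝓕⁻ G η‖ = (π / ε) * rexp (-(π ^ 2 / ε) * ‖η - ξ‖ ^ 2) := by
    intro η
    rw [Real.fourierInv_eq_fourier_neg, hG, fourier_gaussian_innerProductSpace' hε', norm_mul]
    have e1 : (π / ε : ℂ) ^ (Module.finrank ℝ Plane / 2 : ℂ) = ((π / ε : ℝ) : ℂ) := by
      simp
    have e2 : cexp (-π ^ 2 * ‖-ξ - -η‖ ^ 2 / ε)
        = ((rexp (-(π ^ 2 / ε) * ‖η - ξ‖ ^ 2) : ℝ) : ℂ) := by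
      rw [show -ξ - -η = η - ξ by abel]
      push_cast
      congr 1
      ring
    rw [e1, e2, Complex.norm_real, Complex.norm_real, Real.norm_of_nonneg (by positivity),
      Real.norm_of_nonneg (by positivity)]
  have hgi : Integrable (fun η : Plane => rexp (-(π ^ 2 / ε) * ‖η‖ ^ 2)) := by
    have := GaussianFourier.integrable_cexp_neg_mul_sq_norm_add (V := Plane) (b := (π ^ 2 / ε : ℝ))
      (by rw [Complex.ofReal_re]; positivity) 0 0
    refine this.norm.congr (Filter.Eventually.of_forall fun x => ?_)
    simp only [zero_mul, add_zero]
    rw [Complex.norm_exp]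
    congr 1
    norm_cast
  have h_int : ∫ η, ‖𝓕⁻ G η‖ = 1 := by
    simp only [h1]
    rw [integral_const_mul, integral_sub_right_eq_self (fun η : Plane =>
      rexp (-(π ^ 2 / ε) * ‖η‖ ^ 2)), GaussianFourier.integral_rexp_neg_mul_sq_norm (by positivity)]
    simp
    field_simp
  have hinti : Integrable (fun η => ‖𝓕⁻ G η‖) := by
    simp only [h1]
    exact (hgi.comp_sub_right ξ).const_mul _
  have h2 : ∫ x, 𝓕⁻ (𝓕 (f : Plane → ℂ)) x • G x = ∫ η, 𝓕 (f : Plane → ℂ) η • 𝓕⁻ G η := by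
    have h := VectorFourier.integral_fourierIntegral_smul_eq_flip (μ := volume) (ν := volume)
      (L := -innerₗ Plane) (e := 𝐞) Real.continuous_fourierChar
      (by exact continuous_inner.neg) f.fourier_integrable hGint
    have hflip : (-innerₗ Plane).flip = -innerₗ Plane := by
      ext x y; simp [real_inner_comm]
    rw [hflip] at h
    exact h
  have h3 : ∀ x, 𝓕⁻ (𝓕 (f : Plane → ℂ)) x = f x := by
    intro x
    rw [← fourier_coe, ← fourierInv_coe]; simp
  have h4 : ∫ x, (rexp (-ε * ‖x‖ ^ 2) : ℂ) * (cexp ((-2 * π * inner ℝ x ξ : ℝ) * I) * f x)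
      = ∫ x, 𝓕⁻ (𝓕 (f : Plane → ℂ)) x • G x := by
    refine integral_congr_ae (Filter.Eventually.of_forall fun x => ?_)
    simp only [h3, hG, smul_eq_mul]
    rw [← mul_assoc, Complex.ofReal_exp, ← Complex.exp_add, mul_comm]
    congr 2
    rw [inner_neg_left, real_inner_comm]
    push_cast
    ring
  rw [h4, h2]
  calc _ ≤ ∫ η, D * ‖𝓕⁻ G η‖ := by
        refine norm_integral_le_of_norm_le (hinti.const_mul D)
          (Filter.Eventually.of_forall fun η => ?_)
        rw [norm_smul]
        exact mul_le_mul_of_nonneg_right (hD η) (norm_nonneg _)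
    _ = D := by rw [integral_const_mul, h_int, mul_one]

theorem tendsto_gaussian_integral {f : Plane → ℂ} (hf : Integrable f) :
    Filter.Tendsto (fun n : ℕ => ∫ x, (rexp (-(1 / ((n : ℝ) + 1)) * ‖x‖ ^ 2) : ℂ) * f x)
      Filter.atTop (nhds (∫ x, f x)) := by
  refine tendsto_integral_of_dominated_convergence (fun x => ‖f x‖) (fun n => ?_) hf.norm
    (fun n => Filter.Eventually.of_forall fun x => ?_) (Filter.Eventually.of_forall fun x => ?_)
  · exact (by fun_prop : Continuous fun x : Plane =>
      (rexp (-(1 / ((n : ℝ) + 1)) * ‖x‖ ^ 2) : ℂ)).aestronglyMeasurable.mul hf.1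
  · rw [norm_mul, Complex.norm_real, Real.norm_of_nonneg (by positivity)]
    refine mul_le_of_le_one_left (norm_nonneg _) (Real.exp_le_one_iff.2 ?_)
    have : 0 ≤ 1 / ((n : ℝ) + 1) * ‖x‖ ^ 2 := by positivity
    linarith
  · have h : Filter.Tendsto (fun n : ℕ => (rexp (-(1 / ((n : ℝ) + 1)) * ‖x‖ ^ 2) : ℂ))
        Filter.atTop (nhds ((rexp (-0 * ‖x‖ ^ 2) : ℝ) : ℂ)) := by
      refine (Complex.continuous_ofReal.tendsto _).comp ((Real.continuous_exp.tendsto _).comp ?_)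
      exact (tendsto_one_div_add_atTop_nhds_zero_nat.neg).mul_const _
    simpa using h.mul_const (f x)

/-- Differentiation under the integral sign when the derivative is only controlled
after damping by a Gaussian. -/
theorem integral_sub_eq_of_gaussian_bound {s t B D : ℝ} (hst : s ≤ t) {p p' : ℝ → Plane → ℂ}
    (hder : ∀ τ ∈ Set.Icc s t, ∀ x, HasDerivAt (fun τ => p τ x) (p' τ x) τ)
    (hcont : Continuous (Function.uncurry p'))
    (hB : ∀ τ ∈ Set.Icc s t, ∀ x, ‖p' τ x‖ ≤ B)
    (h_int : ∀ τ ∈ Set.Icc s t, Integrable (p' τ))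
    (hs : Integrable (p s)) (ht : Integrable (p t))
    (hD : ∀ ε : ℝ, 0 < ε → ∀ τ ∈ Set.Icc s t,
      ‖∫ x, (rexp (-ε * ‖x‖ ^ 2) : ℂ) * p' τ x‖ ≤ D) :
    IntervalIntegrable (fun τ => ∫ x, p' τ x) volume s t ∧
      (∫ x, p t x) - ∫ x, p s x = ∫ τ in s..t, ∫ x, p' τ x := by
  set χ : ℕ → Plane → ℂ := fun n x => (rexp (-(1 / ((n : ℝ) + 1)) * ‖x‖ ^ 2) : ℂ) with hχ
  have hχc : ∀ n, Continuous (χ n) := fun n => by simp only [hχ]; fun_prop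
  have hχn : ∀ n x, ‖χ n x‖ = rexp (-(1 / ((n : ℝ) + 1)) * ‖x‖ ^ 2) := fun n x => by
    simp only [hχ]
    rw [Complex.norm_real, Real.norm_of_nonneg (by positivity)]
  have hχ1 : ∀ n x, ‖χ n x‖ ≤ 1 := fun n x => by
    rw [hχn]
    refine Real.exp_le_one_iff.2 ?_
    have : 0 ≤ 1 / ((n : ℝ) + 1) * ‖x‖ ^ 2 := by positivity
    linarith
  have hχi : ∀ n, Integrable (χ n) := fun n => by
    have := GaussianFourier.integrable_cexp_neg_mul_sq_norm_add (V := Plane)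
      (b := (1 / ((n : ℝ) + 1) : ℝ)) (by rw [Complex.ofReal_re]; positivity) 0 0
    refine this.congr (Filter.Eventually.of_forall fun x => ?_)
    simp only [hχ, zero_mul, add_zero]
    push_cast
    rfl
  have hprod : ∀ n, Integrable (Function.uncurry fun τ x => χ n x * p' τ x)
      ((volume.restrict (Set.uIoc s t)).prod volume) := by
    intro n
    have hc : Integrable (fun z : ℝ × Plane => (B : ℂ) * χ n z.2)
        ((volume.restrict (Set.uIoc s t)).prod volume) := by
      have h1 : Integrable (fun _ : ℝ => (B : ℂ)) (volume.restrict (Set.uIoc s t)) := by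
        rw [Set.uIoc_of_le hst]; exact integrable_const _
      exact h1.mul_prod (hχi n)
    refine hc.mono ?_ ?_
    · exact (by fun_prop : Continuous fun z : ℝ × Plane => χ n z.2 * Function.uncurry p' z
        ).aestronglyMeasurable
    · have : ∀ᵐ z ∂((volume.restrict (Set.uIoc s t)).prod (volume : Measure Plane)),
          z.1 ∈ Set.uIoc s t := by
        have : ∀ᵐ τ ∂(volume.restrict (Set.uIoc s t)), τ ∈ Set.uIoc s t :=
          ae_restrict_mem measurableSet_uIoc
        exact Measure.quasiMeasurePreserving_fst.ae this
      filter_upwards [this] with z hz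
      rw [Set.uIoc_of_le hst] at hz
      simp only [Function.uncurry, norm_mul, Complex.norm_real]
      rw [mul_comm]
      exact mul_le_mul_of_nonneg_right ((hB _ (Set.Ioc_subset_Icc_self hz) _).trans
        (le_abs_self B)) (norm_nonneg _)
  have hn : ∀ n, (∫ x, χ n x * p t x) - ∫ x, χ n x * p s x
      = ∫ τ in s..t, ∫ x, χ n x * p' τ x := by
    intro n
    have hm : ∀ {g : Plane → ℂ}, Integrable g → Integrable (fun x => χ n x * g x) := fun hg =>
      hg.bdd_mul (hχc n).aestronglyMeasurable (Filter.Eventually.of_forall (hχ1 n))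
    rw [← integral_sub (hm ht) (hm hs), intervalIntegral.integral_of_le hst]
    have hsw := integral_integral_swap (hprod n)
    rw [Set.uIoc_of_le hst] at hsw
    rw [hsw]
    refine integral_congr_ae (Filter.Eventually.of_forall fun x => ?_)
    simp only
    rw [← intervalIntegral.integral_of_le hst, intervalIntegral.integral_const_mul,
      intervalIntegral.integral_eq_sub_of_hasDerivAt (f := fun τ => p τ x)]
    · ring
    · intro τ hτ
      rw [Set.uIcc_of_le hst] at hτ
      exact hder τ hτ x
    · exact (hcont.comp (by fun_prop : Continuous fun τ : ℝ => (τ, x))).intervalIntegrable _ _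
  have hlim : ∀ τ ∈ Set.Icc s t, Filter.Tendsto (fun n => ∫ x, χ n x * p' τ x) Filter.atTop
      (nhds (∫ x, p' τ x)) := fun τ hτ => tendsto_gaussian_integral (h_int τ hτ)
  have hmeas : ∀ n, AEStronglyMeasurable (fun τ => ∫ x, χ n x * p' τ x)
      (volume.restrict (Set.uIoc s t)) := fun n => (hprod n).integral_prod_left.1
  have hmem : ∀ᵐ τ ∂(volume.restrict (Set.uIoc s t)), τ ∈ Set.Icc s t := by
    filter_upwards [ae_restrict_mem measurableSet_uIoc] with τ hτ
    rw [Set.uIoc_of_le hst] at hτ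
    exact Set.Ioc_subset_Icc_self hτ
  have hmeas' : AEStronglyMeasurable (fun τ => ∫ x, p' τ x)
      (volume.restrict (Set.uIoc s t)) :=
    aestronglyMeasurable_of_tendsto_ae Filter.atTop hmeas (by
      filter_upwards [hmem] with τ hτ using hlim τ hτ)
  have hDn : ∀ n, ∀ τ ∈ Set.Icc s t, ‖∫ x, χ n x * p' τ x‖ ≤ D := fun n τ hτ =>
    hD _ (by positivity) τ hτ
  refine ⟨?_, ?_⟩
  · refine (intervalIntegrable_const (c := D)).mono_fun hmeas' ?_
    filter_upwards [hmem] with τ hτ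
    exact (le_of_tendsto (hlim τ hτ).norm (Filter.Eventually.of_forall fun n => hDn n τ hτ)).trans
      (le_abs_self D)
  · refine tendsto_nhds_unique ((tendsto_gaussian_integral ht).sub (tendsto_gaussian_integral hs))
      ?_
    have := intervalIntegral.tendsto_integral_filter_of_dominated_convergence
      (μ := volume) (a := s) (b := t) (F := fun n τ => ∫ x, χ n x * p' τ x)
      (f := fun τ => ∫ x, p' τ x) (l := Filter.atTop) (fun _ => D)
      (Filter.Eventually.of_forall hmeas)
      (Filter.Eventually.of_forall fun n => Filter.Eventually.of_forall fun τ hτ => hDn n τ (by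
        rw [Set.uIoc_of_le hst] at hτ; exact Set.Ioc_subset_Icc_self hτ))
      intervalIntegrable_const
      (Filter.Eventually.of_forall fun τ hτ => hlim τ (by
        rw [Set.uIoc_of_le hst] at hτ; exact Set.Ioc_subset_Icc_self hτ))
    simpa only [← hn] using this

/-- The time derivative of a function of `(t, x)`. -/
def dt (u : ℝ → Plane → ℂ) (τ : ℝ) (x : Plane) : ℂ := fderiv ℝ (Function.uncurry u) (τ, x) (1, 0)

theorem continuous_dt {u : ℝ → Plane → ℂ} (hu : ContDiff ℝ ∞ (Function.uncurry u)) :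
    Continuous (Function.uncurry (dt u)) := by
  have h := hu.continuous_fderiv (by simp)
  exact h.clm_apply continuous_const

theorem hasDerivAt_dt {u : ℝ → Plane → ℂ} (hu : ContDiff ℝ ∞ (Function.uncurry u))
    (τ : ℝ) (x : Plane) : HasDerivAt (fun τ => u τ x) (dt u τ x) τ := by
  have h := (hu.differentiable (by simp) (τ, x)).hasFDerivAt
  have h2 : HasDerivAt (fun τ : ℝ => (τ, x)) ((1 : ℝ), (0 : Plane)) τ :=
    (hasDerivAt_id τ).prodMk (hasDerivAt_const τ x)
  exact h.comp_hasDerivAt τ h2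

/-- `S` is the Schwartz version of a smooth solution `u` of the cubic equation on `[s, t]`. -/
structure IsFlowOn (s t : ℝ) (u : ℝ → Plane → ℂ) (S : ℝ → 𝓢(Plane, ℂ)) : Prop where
  contDiff : ContDiff ℝ ∞ (Function.uncurry u)
  coe : ∀ τ ∈ Set.Icc s t, ∀ x, S τ x = u τ x
  dt_eq : ∀ τ ∈ Set.Icc s t, ∀ x, dt u τ x = rhsS (S τ) x

theorem IsFlowOn.mono {s t s' t' : ℝ} {u : ℝ → Plane → ℂ} {S : ℝ → 𝓢(Plane, ℂ)}
    (h : IsFlowOn s t u S) (hs : s ≤ s') (ht : t' ≤ t) : IsFlowOn s' t' u S :=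
  ⟨h.contDiff, fun τ hτ => h.coe τ (Set.Icc_subset_Icc hs ht hτ),
    fun τ hτ => h.dt_eq τ (Set.Icc_subset_Icc hs ht hτ)⟩

section Flow

variable {s t M : ℝ} {u : ℝ → Plane → ℂ} {S : ℝ → 𝓢(Plane, ℂ)}

theorem IsFlowOn.fourier_sub_eq_integral (h : IsFlowOn s t u S) (hst : s ≤ t)
    (hM : ∀ τ ∈ Set.Icc s t, FourierDecay M (S τ)) (ξ : Plane) :
    IntervalIntegrable (fun τ => 𝓕 (rhsS (S τ) : Plane → ℂ) ξ) volume s t ∧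
      𝓕 (S t : Plane → ℂ) ξ - 𝓕 (S s : Plane → ℂ) ξ
        = ∫ τ in s..t, 𝓕 (rhsS (S τ) : Plane → ℂ) ξ := by
  set e : Plane → ℂ := fun x => cexp ((-2 * π * inner ℝ x ξ : ℝ) * I) with he
  have hec : Continuous e := by simp only [he]; fun_prop
  have hen : ∀ x, ‖e x‖ = 1 := fun x => Complex.norm_exp_ofReal_mul_I _
  have hF : ∀ f : 𝓢(Plane, ℂ), 𝓕 (f : Plane → ℂ) ξ = ∫ x, e x * f x := fun f => by
    rw [Real.fourier_eq']; rfl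
  have hi : ∀ f : 𝓢(Plane, ℂ), Integrable (fun x => e x * f x) := fun f =>
    f.integrable.bdd_mul (c := 1) hec.aestronglyMeasurable
      (Filter.Eventually.of_forall fun x => (hen x).le)
  have hpS : ∀ τ ∈ Set.Icc s t, (fun x => e x * u τ x) = fun x => e x * S τ x := fun τ hτ => by
    ext x; rw [h.coe τ hτ]
  have hqS : ∀ τ ∈ Set.Icc s t, (fun x => e x * dt u τ x) = fun x => e x * rhsS (S τ) x :=
    fun τ hτ => by ext x; rw [h.dt_eq τ hτ]
  have key := integral_sub_eq_of_gaussian_bound (p := fun τ x => e x * u τ x)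
    (p' := fun τ x => e x * dt u τ x) (B := rhsBound M * weightIntegral) (D := rhsBound M) hst
    (fun τ _ x => (hasDerivAt_dt h.contDiff τ x).const_mul _)
    (by
      have := continuous_dt h.contDiff
      exact (hec.comp continuous_snd).mul this)
    (fun τ hτ x => by
      rw [norm_mul, hen, one_mul, h.dt_eq τ hτ]
      exact norm_rhsS_le (hM τ hτ) x)
    (fun τ hτ => by rw [hqS τ hτ]; exact hi _)
    (by rw [hpS s ⟨le_rfl, hst⟩]; exact hi _)
    (by rw [hpS t ⟨hst, le_rfl⟩]; exact hi _)
    (fun ε hε τ hτ => by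
      have := norm_integral_gaussian_mul_le (norm_fourier_rhsS_le_const (hM τ hτ)) hε ξ
      simpa only [h.dt_eq τ hτ] using this)
  have hqI : ∀ τ ∈ Set.Icc s t, ∫ x, e x * dt u τ x = 𝓕 (rhsS (S τ) : Plane → ℂ) ξ :=
    fun τ hτ => by rw [hF, hqS τ hτ]
  refine ⟨key.1.congr fun τ hτ => ?_, ?_⟩
  · rw [Set.uIoc_of_le hst] at hτ
    exact hqI τ (Set.Ioc_subset_Icc_self hτ)
  · rw [hF, hF, ← hpS s ⟨le_rfl, hst⟩, ← hpS t ⟨hst, le_rfl⟩, key.2]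
    refine intervalIntegral.integral_congr fun τ hτ => ?_
    rw [Set.uIcc_of_le hst] at hτ
    exact hqI τ hτ

theorem IsFlowOn.norm_fourier_sub_le (h : IsFlowOn s t u S)
    (hM : ∀ τ ∈ Set.Icc s t, FourierDecay M (S τ)) (ξ : Plane) {a b : ℝ}
    (ha : a ∈ Set.Icc s t) (hb : b ∈ Set.Icc s t) :
    ‖𝓕 (S b : Plane → ℂ) ξ - 𝓕 (S a : Plane → ℂ) ξ‖ ≤ rhsBound M * |b - a| := by
  wlog hab : a ≤ b generalizing a b
  · rw [norm_sub_rev, abs_sub_comm]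
    exact this hb ha (le_of_not_ge hab)
  have hM' : ∀ τ ∈ Set.Icc a b, FourierDecay M (S τ) := fun τ hτ =>
    hM τ ⟨ha.1.trans hτ.1, hτ.2.trans hb.2⟩
  rw [((h.mono ha.1 hb.2).fourier_sub_eq_integral hab hM' ξ).2]
  refine intervalIntegral.norm_integral_le_of_norm_le_const fun τ hτ => ?_
  rw [Set.uIoc_of_le hab] at hτ
  exact norm_fourier_rhsS_le_const (hM' τ (Set.Ioc_subset_Icc_self hτ)) ξ

theorem IsFlowOn.continuousOn_fourier (h : IsFlowOn s t u S)
    (hM : ∀ τ ∈ Set.Icc s t, FourierDecay M (S τ)) (ξ : Plane) :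
    ContinuousOn (fun τ => 𝓕 (S τ : Plane → ℂ) ξ) (Set.Icc s t) := by
  refine LipschitzOnWith.continuousOn (K := (rhsBound M).toNNReal)
    (LipschitzOnWith.of_dist_le_mul fun b hb a ha => ?_)
  rw [dist_eq_norm, Real.dist_eq, Real.coe_toNNReal _ (rhsBound_nonneg (hM a ha).nonneg)]
  exact h.norm_fourier_sub_le hM ξ ha hb

end Flow

theorem continuousOn_fourier_mulS {A : Set ℝ} {M M' : ℝ} {f g : ℝ → 𝓢(Plane, ℂ)}
    (hf : ∀ τ ∈ A, FourierDecay M (f τ)) (hg : ∀ τ ∈ A, FourierDecay M' (g τ))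
    (hfc : ∀ ξ, ContinuousOn (fun τ => 𝓕 (f τ : Plane → ℂ) ξ) A)
    (hgc : ∀ ξ, ContinuousOn (fun τ => 𝓕 (g τ : Plane → ℂ) ξ) A) (ξ : Plane) :
    ContinuousOn (fun τ => 𝓕 (mulS (f τ) (g τ) : Plane → ℂ) ξ) A := by
  simp only [fourier_mulS]
  refine continuousOn_of_dominated (bound := fun η => M * ((1 + ‖η‖) ^ 6)⁻¹ * M')
    (fun τ _ => ((fourier_continuous (f τ)).mul
      ((fourier_continuous (g τ)).comp (continuous_const.sub continuous_id))).aestronglyMeasurable)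
    (fun τ hτ => Filter.Eventually.of_forall fun η => ?_)
    (((integrable_inv_one_add_norm_pow (by norm_num)).const_mul M).mul_const M')
    (Filter.Eventually.of_forall fun η => (hfc η).mul (hgc (ξ - η)))
  rw [norm_mul]
  have := (hf τ hτ).nonneg
  exact mul_le_mul ((hf τ hτ).norm_le η) ((hg τ hτ).norm_le_const _) (norm_nonneg _)
    (by positivity)

theorem fourierDecay_mulS_uniform {M M' : ℝ} {f g : 𝓢(Plane, ℂ)} (hf : FourierDecay M f)
    (hg : FourierDecay M' g) : FourierDecay (64 * weightIntegral * M * M') (mulS f g) := by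
  refine (fourierDecay_mulS hf hg).mono ?_
  have h1 := mul_le_mul_of_nonneg_left (wienerNorm_le_of_decay hg) hf.nonneg
  have h2 := mul_le_mul_of_nonneg_right (wienerNorm_le_of_decay hf) hg.nonneg
  linarith

theorem continuousOn_fourier_cubicS {A : Set ℝ} {M : ℝ} {f : ℝ → 𝓢(Plane, ℂ)}
    (hf : ∀ τ ∈ A, FourierDecay M (f τ))
    (hfc : ∀ ξ, ContinuousOn (fun τ => 𝓕 (f τ : Plane → ℂ) ξ) A) (ξ : Plane) :
    ContinuousOn (fun τ => 𝓕 (cubicS (f τ) : Plane → ℂ) ξ) A := by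
  have hc : ∀ ξ, ContinuousOn (fun τ => 𝓕 (conjS (f τ) : Plane → ℂ) ξ) A := fun ξ => by
    simp only [fourier_conjS]
    exact Complex.continuous_conj.comp_continuousOn (hfc (-ξ))
  have hcd : ∀ τ ∈ A, FourierDecay M (conjS (f τ)) := fun τ hτ => fourierDecay_conjS (hf τ hτ)
  exact continuousOn_fourier_mulS (fun τ hτ => fourierDecay_mulS_uniform (hf τ hτ) (hcd τ hτ)) hf
    (continuousOn_fourier_mulS hf hcd hfc hc) hfc ξ

section Flow

variable {s t M : ℝ} {u : ℝ → Plane → ℂ} {S : ℝ → 𝓢(Plane, ℂ)}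

theorem IsFlowOn.continuousOn_fourier_cubicS (h : IsFlowOn s t u S)
    (hM : ∀ τ ∈ Set.Icc s t, FourierDecay M (S τ)) (ξ : Plane) :
    ContinuousOn (fun τ => 𝓕 (cubicS (S τ) : Plane → ℂ) ξ) (Set.Icc s t) :=
  SchwartzMap.continuousOn_fourier_cubicS hM (h.continuousOn_fourier hM) ξ

theorem IsFlowOn.continuousOn_fourier_rhsS (h : IsFlowOn s t u S)
    (hM : ∀ τ ∈ Set.Icc s t, FourierDecay M (S τ)) (ξ : Plane) :
    ContinuousOn (fun τ => 𝓕 (rhsS (S τ) : Plane → ℂ) ξ) (Set.Icc s t) := by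
  simp only [fourier_rhsS]
  exact continuousOn_const.mul ((continuousOn_const.mul (h.continuousOn_fourier hM ξ)).add
    (h.continuousOn_fourier_cubicS hM ξ))

theorem IsFlowOn.hasDerivAt_fourier (h : IsFlowOn s t u S)
    (hM : ∀ τ ∈ Set.Icc s t, FourierDecay M (S τ)) (ξ : Plane) {τ : ℝ} (hτ : τ ∈ Set.Ioo s t) :
    HasDerivAt (fun τ => 𝓕 (S τ : Plane → ℂ) ξ) (𝓕 (rhsS (S τ) : Plane → ℂ) ξ) τ := by
  have hq := h.continuousOn_fourier_rhsS hM ξ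
  have hnhds : Set.Icc s t ∈ nhds τ := Icc_mem_nhds hτ.1 hτ.2
  have hτ' := Set.Ioo_subset_Icc_self hτ
  have hst := hτ'.1.trans hτ'.2
  have h_int : IntervalIntegrable (fun τ => 𝓕 (rhsS (S τ) : Plane → ℂ) ξ) volume s τ := by
    refine (hq.mono ?_).intervalIntegrable
    rw [Set.uIcc_of_le hτ'.1]
    exact Set.Icc_subset_Icc_right hτ'.2
  have h1 := intervalIntegral.integral_hasDerivAt_right h_int
    (hq.stronglyMeasurableAtFilter_nhdsWithin measurableSet_Icc τ |> fun h => by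
      rwa [nhdsWithin_eq_nhds.2 hnhds] at h) (hq.continuousAt hnhds)
  refine (h1.const_add (𝓕 (S s : Plane → ℂ) ξ)).congr_of_eventuallyEq ?_
  filter_upwards [hnhds] with σ hσ
  rw [← ((h.mono le_rfl hσ.2).fourier_sub_eq_integral hσ.1
    (fun τ hτ => hM τ ⟨hτ.1, hτ.2.trans hσ.2⟩) ξ).2]
  ring

theorem IsFlowOn.abs_norm_fourier_sub_le (h : IsFlowOn s t u S)
    (hM : ∀ τ ∈ Set.Icc s t, FourierDecay M (S τ)) (ξ : Plane) {a b : ℝ}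
    (ha : a ∈ Set.Icc s t) (hb : b ∈ Set.Icc s t) (hab : a ≤ b) :
    |‖𝓕 (S b : Plane → ℂ) ξ‖ - ‖𝓕 (S a : Plane → ℂ) ξ‖|
      ≤ ∫ τ in a..b, ‖𝓕 (cubicS (S τ) : Plane → ℂ) ξ‖ := by
  set θ : ℝ := 4 * π ^ 2 * ‖ξ‖ ^ 2 with hθ
  set E : ℝ → ℂ := fun τ => cexp ((θ * τ : ℝ) * I) with hE
  have hEn : ∀ τ, ‖E τ‖ = 1 := fun τ => Complex.norm_exp_ofReal_mul_I _
  have hEd : ∀ τ, HasDerivAt E (E τ * (θ * I)) τ := fun τ => by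
    have h1 : HasDerivAt (fun τ : ℝ => ((θ * τ : ℝ) : ℂ) * I) (θ * I) τ := by
      have := ((hasDerivAt_id τ).const_mul θ).ofReal_comp.mul_const I
      simpa using this
    exact h1.cexp
  have hEc : Continuous E := continuous_iff_continuousAt.2 fun τ => (hEd τ).continuousAt
  have hsub : Set.Icc a b ⊆ Set.Icc s t := Set.Icc_subset_Icc ha.1 hb.2
  have hN : ContinuousOn (fun τ => E τ * (-I * 𝓕 (cubicS (S τ) : Plane → ℂ) ξ)) (Set.Icc a b) :=
    hEc.continuousOn.mul (continuousOn_const.mul ((h.continuousOn_fourier_cubicS hM ξ).mono hsub))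
  have key := intervalIntegral.integral_eq_sub_of_hasDerivAt_of_le hab
    (f := fun τ => E τ * 𝓕 (S τ : Plane → ℂ) ξ)
    (f' := fun τ => E τ * (-I * 𝓕 (cubicS (S τ) : Plane → ℂ) ξ))
    (hEc.continuousOn.mul ((h.continuousOn_fourier hM ξ).mono hsub))
    (fun τ hτ => by
      have hd := (hEd τ).mul (h.hasDerivAt_fourier hM ξ
        (⟨ha.1.trans_lt hτ.1, hτ.2.trans_le hb.2⟩ : τ ∈ Set.Ioo s t))
      refine HasDerivAt.congr_deriv hd ?_
      rw [fourier_rhsS]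
      ring)
    (hN.intervalIntegrable_of_Icc hab)
  calc _ = |‖E b * 𝓕 (S b : Plane → ℂ) ξ‖ - ‖E a * 𝓕 (S a : Plane → ℂ) ξ‖| := by
        simp only [norm_mul, hEn, one_mul]
    _ ≤ ‖E b * 𝓕 (S b : Plane → ℂ) ξ - E a * 𝓕 (S a : Plane → ℂ) ξ‖ := abs_norm_sub_norm_le _ _
    _ ≤ _ := by
      rw [← key]
      refine (intervalIntegral.norm_integral_le_integral_norm hab).trans (le_of_eq ?_)
      simp only [norm_mul, hEn, one_mul, norm_neg, Complex.norm_I]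

end Flow

/-- The square of the `H¹` norm, on the Fourier side. -/
def kin (f : 𝓢(Plane, ℂ)) : ℝ :=
  ∫ ξ, (1 + 4 * π ^ 2 * ‖ξ‖ ^ 2) * ‖𝓕 (f : Plane → ℂ) ξ‖ ^ 2

/-- The fourth power of the `L⁴` norm. -/
def quart (f : 𝓢(Plane, ℂ)) : ℝ := ∫ x, ‖f x‖ ^ 4

/-- The power `Re ∫ conj(|f|²f) ∂ₜf` of the nonlinear term. -/
def power (f : 𝓢(Plane, ℂ)) : ℝ := (∫ x, (starRingEnd ℂ) (cubicS f x) * rhsS f x).re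

theorem integrable_conj_mul (f g : 𝓢(Plane, ℂ)) :
    Integrable (fun x => (starRingEnd ℂ) (f x) * g x) := by
  refine (mulS (conjS f) g).integrable.congr (Filter.Eventually.of_forall fun x => ?_)
  simp only [mulS_apply, conjS_apply]

theorem integrable_conj_mul_fourier (f g : 𝓢(Plane, ℂ)) :
    Integrable (fun ξ => (starRingEnd ℂ) (𝓕 (f : Plane → ℂ) ξ) * 𝓕 (g : Plane → ℂ) ξ) :=
  integrable_conj_mul (𝓕 f) (𝓕 g)

theorem integral_conj_mul_cubicS_im (f : 𝓢(Plane, ℂ)) :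
    (∫ x, (starRingEnd ℂ) (f x) * cubicS f x).im = 0 := by
  have : ∀ x, (starRingEnd ℂ) (f x) * cubicS f x = ((‖f x‖ ^ 4 : ℝ) : ℂ) := fun x => by
    rw [cubicS_apply, mul_left_comm, mul_comm ((starRingEnd ℂ) (f x)), Complex.mul_conj,
      Complex.normSq_eq_norm_sq]
    push_cast
    ring
  simp only [this]
  rw [integral_complex_ofReal]
  simp

theorem integral_kin_deriv (f : 𝓢(Plane, ℂ)) :
    ∫ ξ, (1 + 4 * π ^ 2 * ‖ξ‖ ^ 2) *
      (2 * inner ℝ (𝓕 (f : Plane → ℂ) ξ) (𝓕 (rhsS f : Plane → ℂ) ξ)) = -2 * power f := by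
  have h : ∀ ξ, (1 + 4 * π ^ 2 * ‖ξ‖ ^ 2) *
      (2 * inner ℝ (𝓕 (f : Plane → ℂ) ξ) (𝓕 (rhsS f : Plane → ℂ) ξ))
      = 2 * ((starRingEnd ℂ) (𝓕 (f : Plane → ℂ) ξ) * 𝓕 (cubicS f : Plane → ℂ) ξ).im
        - 2 * ((starRingEnd ℂ) (𝓕 (cubicS f : Plane → ℂ) ξ) * 𝓕 (rhsS f : Plane → ℂ) ξ).re := by
    intro ξ
    rw [Complex.inner, fourier_rhsS]
    simp only [Complex.mul_re, Complex.mul_im, Complex.add_re, Complex.add_im, Complex.conj_re,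
      Complex.conj_im, Complex.neg_re, Complex.neg_im, Complex.I_re, Complex.I_im,
      Complex.ofReal_re, Complex.ofReal_im]
    ring
  simp only [h]
  have i1 := integrable_conj_mul_fourier f (cubicS f)
  have i2 := integrable_conj_mul_fourier (cubicS f) (rhsS f)
  have e1 := integral_im i1
  have e2 := integral_re i2
  simp only [RCLike.im_to_complex, RCLike.re_to_complex] at e1 e2
  have i3 : Integrable fun ξ =>
      ((starRingEnd ℂ) (𝓕 (f : Plane → ℂ) ξ) * 𝓕 (cubicS f : Plane → ℂ) ξ).im := i1.im
  have i4 : Integrable fun ξ =>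
      ((starRingEnd ℂ) (𝓕 (cubicS f : Plane → ℂ) ξ) * 𝓕 (rhsS f : Plane → ℂ) ξ).re := i2.re
  rw [integral_sub (i3.const_mul 2) (i4.const_mul 2), integral_const_mul, integral_const_mul,
    e1, e2, plancherel_conj, plancherel_conj, integral_conj_mul_cubicS_im, power]
  ring

theorem one_add_sq_le (ξ : Plane) :
    1 + 4 * π ^ 2 * ‖ξ‖ ^ 2 ≤ 4 * π ^ 2 * (1 + ‖ξ‖) ^ 2 := by
  have h1 : 1 ≤ π ^ 2 := one_le_pow₀ (by linarith [Real.two_le_pi])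
  have h2 : 0 ≤ π ^ 2 * ‖ξ‖ := by positivity
  nlinarith

theorem kin_integrand_le {M : ℝ} {f : Plane → ℂ} (h : FourierDecay M f) (ξ : Plane) :
    (1 + 4 * π ^ 2 * ‖ξ‖ ^ 2) * ‖𝓕 f ξ‖ ^ 2 ≤ 4 * π ^ 2 * M ^ 2 * ((1 + ‖ξ‖) ^ 10)⁻¹ := by
  have h0 := h.norm_le ξ
  calc _ ≤ (4 * π ^ 2 * (1 + ‖ξ‖) ^ 2) * (M * ((1 + ‖ξ‖) ^ 6)⁻¹) ^ 2 := by
        gcongr; exact one_add_sq_le ξ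
    _ = _ := by
        have : (1 + ‖ξ‖) ≠ 0 := by positivity
        field_simp

theorem kin_deriv_integrand_le {M : ℝ} {f : 𝓢(Plane, ℂ)} (h : FourierDecay M f) (ξ : Plane) :
    ‖(1 + 4 * π ^ 2 * ‖ξ‖ ^ 2) *
      (2 * inner ℝ (𝓕 (f : Plane → ℂ) ξ) (𝓕 (rhsS f : Plane → ℂ) ξ))‖
      ≤ 8 * π ^ 2 * M * rhsBound M * ((1 + ‖ξ‖) ^ 8)⁻¹ := by
  have h0 := h.norm_le ξ
  have h1 := norm_fourier_rhsS_le h ξ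
  have hM := h.nonneg
  rw [norm_mul, norm_mul, Real.norm_of_nonneg (by positivity), Real.norm_ofNat]
  calc _ ≤ (4 * π ^ 2 * (1 + ‖ξ‖) ^ 2) * (2 * (‖𝓕 (f : Plane → ℂ) ξ‖
            * ‖𝓕 (rhsS f : Plane → ℂ) ξ‖)) := by
        gcongr
        · exact one_add_sq_le ξ
        · exact norm_inner_le_norm _ _
    _ ≤ (4 * π ^ 2 * (1 + ‖ξ‖) ^ 2) * (2 * ((M * ((1 + ‖ξ‖) ^ 6)⁻¹)
            * (rhsBound M * ((1 + ‖ξ‖) ^ 4)⁻¹))) := by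
        gcongr
    _ = _ := by
        have : (1 + ‖ξ‖) ≠ 0 := by positivity
        field_simp
        ring

theorem integral_norm_sq_le {M : ℝ} {f : 𝓢(Plane, ℂ)} (h : FourierDecay M f) :
    ∫ x, ‖f x‖ ^ 2 ≤ M ^ 2 * weightIntegral := by
  rw [← plancherel, weightIntegral, ← integral_const_mul]
  refine integral_mono (integrable_norm_sq (𝓕 f))
    ((integrable_inv_one_add_norm_pow (by norm_num)).const_mul _) fun ξ => ?_
  have h0 := h.norm_le ξ
  have h1 : 1 ≤ 1 + ‖ξ‖ := by linarith [norm_nonneg ξ]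
  calc ‖𝓕 (f : Plane → ℂ) ξ‖ ^ 2 ≤ (M * ((1 + ‖ξ‖) ^ 6)⁻¹) ^ 2 := by gcongr
    _ = M ^ 2 * ((1 + ‖ξ‖) ^ 12)⁻¹ := by rw [mul_pow, inv_pow, ← pow_mul]
    _ ≤ M ^ 2 * ((1 + ‖ξ‖) ^ 4)⁻¹ := by gcongr; norm_num

theorem quart_le {M : ℝ} {f : 𝓢(Plane, ℂ)} (h : FourierDecay M f) :
    quart f ≤ (M * weightIntegral) ^ 2 * (M ^ 2 * weightIntegral) := by
  have hw : ∀ x, ‖f x‖ ≤ M * weightIntegral := fun x =>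
    (norm_le_wienerNorm f x).trans (wienerNorm_le_of_decay h)
  calc quart f ≤ ∫ x, (M * weightIntegral) ^ 2 * ‖f x‖ ^ 2 := by
        refine integral_mono_of_nonneg (Filter.Eventually.of_forall fun _ => by positivity)
          ((integrable_norm_sq f).const_mul _) (Filter.Eventually.of_forall fun x => ?_)
        simp only
        calc ‖f x‖ ^ 4 = ‖f x‖ ^ 2 * ‖f x‖ ^ 2 := by ring
          _ ≤ _ := by have := hw x; gcongr
    _ ≤ _ := by
        rw [integral_const_mul]
        have := integral_norm_sq_le h
        gcongr

theorem kin_le {M : ℝ} {f : 𝓢(Plane, ℂ)} (h : FourierDecay M f) :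
    kin f ≤ 4 * π ^ 2 * M ^ 2 * weightIntegral := by
  rw [kin, weightIntegral, ← integral_const_mul]
  refine integral_mono_of_nonneg (Filter.Eventually.of_forall fun _ => by positivity)
    ((integrable_inv_one_add_norm_pow (by norm_num)).const_mul _)
    (Filter.Eventually.of_forall fun ξ => (kin_integrand_le h ξ).trans ?_)
  have h1 : 1 ≤ 1 + ‖ξ‖ := by linarith [norm_nonneg ξ]
  simp only
  gcongr
  norm_num

theorem integrable_kin (f : 𝓢(Plane, ℂ)) :
    Integrable (fun ξ => (1 + 4 * π ^ 2 * ‖ξ‖ ^ 2) * ‖𝓕 (f : Plane → ℂ) ξ‖ ^ 2) := by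
  obtain ⟨M, h⟩ := exists_fourierDecay f
  have := f.fourier_continuous
  refine ((integrable_inv_one_add_norm_pow (k := 10) (by norm_num)).const_mul
    (4 * π ^ 2 * M ^ 2)).mono' (by fun_prop) (Filter.Eventually.of_forall fun ξ => ?_)
  rw [Real.norm_of_nonneg (by positivity)]
  exact kin_integrand_le h ξ

theorem quart_nonneg (f : 𝓢(Plane, ℂ)) : 0 ≤ quart f := integral_nonneg fun _ => by positivity

theorem integrable_quart (f : 𝓢(Plane, ℂ)) : Integrable (fun x => ‖f x‖ ^ 4) :=
  (f.memLp 4).integrable_norm_pow (by norm_num)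

section Flow

variable {s t M : ℝ} {u : ℝ → Plane → ℂ} {S : ℝ → 𝓢(Plane, ℂ)}

theorem IsFlowOn.quart_sub (h : IsFlowOn s t u S) (hst : s ≤ t)
    (hM : ∀ τ ∈ Set.Icc s t, FourierDecay M (S τ)) :
    IntervalIntegrable (fun τ => power (S τ)) volume s t ∧
      quart (S t) - quart (S s) = ∫ τ in s..t, 4 * power (S τ) := by
  have hp' : ∀ τ ∈ Set.Icc s t, ∀ x, 4 * ‖u τ x‖ ^ 2 * inner ℝ (u τ x) (dt u τ x)
      = 4 * ((starRingEnd ℂ) (cubicS (S τ) x) * rhsS (S τ) x).re := fun τ hτ x => by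
    rw [← h.coe τ hτ, h.dt_eq τ hτ, cubicS_apply, map_mul, Complex.conj_ofReal, Complex.inner,
      mul_assoc, mul_assoc, Complex.re_ofReal_mul, mul_comm (rhsS (S τ) x)]
  have hM0 : 0 ≤ M := (hM s ⟨le_rfl, hst⟩).nonneg
  have hw0 := weightIntegral_nonneg
  have hR := rhsBound_nonneg hM0
  set w := M * weightIntegral with hw
  set R := rhsBound M * weightIntegral with hRd
  have hS : ∀ τ ∈ Set.Icc s t, ∀ x, ‖u τ x‖ ≤ w := fun τ hτ x => by
    rw [← h.coe τ hτ]
    exact (norm_le_wienerNorm _ x).trans (wienerNorm_le_of_decay (hM τ hτ))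
  have hpn : ∀ τ ∈ Set.Icc s t, ∀ x,
      ‖((4 * ‖u τ x‖ ^ 2 * inner ℝ (u τ x) (dt u τ x) : ℝ) : ℂ)‖ ≤ 4 * w * R * ‖u τ x‖ ^ 2 := by
    intro τ hτ x
    have h1 := norm_inner_le_norm (𝕜 := ℝ) (u τ x) (dt u τ x)
    have h2 : ‖dt u τ x‖ ≤ R := by rw [h.dt_eq τ hτ]; exact norm_rhsS_le (hM τ hτ) x
    rw [Complex.norm_real, norm_mul, Real.norm_of_nonneg (by positivity)]
    calc _ ≤ 4 * ‖u τ x‖ ^ 2 * (w * R) := by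
          gcongr
          refine h1.trans ?_
          have := hS τ hτ x
          gcongr
      _ = _ := by ring
  have h_int : ∀ τ ∈ Set.Icc s t, (∫ x, ((4 * ‖u τ x‖ ^ 2 * inner ℝ (u τ x) (dt u τ x) : ℝ) : ℂ))
      = ((4 * power (S τ) : ℝ) : ℂ) := by
    intro τ hτ
    rw [integral_complex_ofReal]
    congr 1
    simp only [hp' τ hτ]
    have e2 := integral_re (integrable_conj_mul (cubicS (S τ)) (rhsS (S τ)))
    simp only [RCLike.re_to_complex] at e2
    rw [integral_const_mul, e2, power]
  have hii : ∀ τ ∈ Set.Icc s t,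
      Integrable (fun x => ((4 * ‖u τ x‖ ^ 2 * inner ℝ (u τ x) (dt u τ x) : ℝ) : ℂ)) := by
    intro τ hτ
    simp only [hp' τ hτ]
    exact ((integrable_conj_mul (cubicS (S τ)) (rhsS (S τ))).re.const_mul 4).ofReal
  have hq : ∀ τ ∈ Set.Icc s t, (fun x => ((‖u τ x‖ ^ 4 : ℝ) : ℂ))
      = fun x => ((‖S τ x‖ ^ 4 : ℝ) : ℂ) := fun τ hτ => by ext x; rw [h.coe τ hτ]
  have hqi : ∀ τ ∈ Set.Icc s t, Integrable (fun x => ((‖u τ x‖ ^ 4 : ℝ) : ℂ)) := fun τ hτ => by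
    rw [hq τ hτ]; exact (integrable_quart _).ofReal
  have hqe : ∀ τ ∈ Set.Icc s t, ∫ x, ((‖u τ x‖ ^ 4 : ℝ) : ℂ) = ((quart (S τ) : ℝ) : ℂ) :=
    fun τ hτ => by rw [hq τ hτ, integral_complex_ofReal]; rfl
  have huc : Continuous (Function.uncurry u) := h.contDiff.continuous
  have key := integral_sub_eq_of_gaussian_bound (p := fun τ x => ((‖u τ x‖ ^ 4 : ℝ) : ℂ))
    (p' := fun τ x => ((4 * ‖u τ x‖ ^ 2 * inner ℝ (u τ x) (dt u τ x) : ℝ) : ℂ))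
    (B := 4 * w * R * w ^ 2) (D := 4 * w * R * (M ^ 2 * weightIntegral)) hst
    (fun τ _ x => by
      have h1 := ((hasDerivAt_dt h.contDiff τ x).norm_sq.pow 2).ofReal_comp
      refine (h1.congr_deriv ?_).congr_of_eventuallyEq (Filter.Eventually.of_forall fun σ => ?_)
      · push_cast; ring
      · simp only [Pi.pow_apply]; push_cast; ring)
    (by
      have := continuous_dt h.contDiff
      exact Complex.continuous_ofReal.comp ((continuous_const.mul (huc.norm.pow 2)).mul
        (huc.inner this)))
    (fun τ hτ x => (hpn τ hτ x).trans (by have := hS τ hτ x; gcongr))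
    hii (hqi s ⟨le_rfl, hst⟩) (hqi t ⟨hst, le_rfl⟩)
    (fun ε hε τ hτ => by
      have hsq : Integrable (fun x => ‖u τ x‖ ^ 2) := by
        simp only [← h.coe τ hτ]; exact integrable_norm_sq (S τ)
      refine (norm_integral_le_of_norm_le (hsq.const_mul (4 * w * R))
        (Filter.Eventually.of_forall fun x => ?_)).trans ?_
      · refine le_trans ?_ (hpn τ hτ x)
        rw [norm_mul]
        refine mul_le_of_le_one_left (norm_nonneg _) ?_
        rw [Complex.norm_real, Real.norm_of_nonneg (by positivity)]
        refine Real.exp_le_one_iff.2 ?_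
        have : 0 ≤ ε * ‖x‖ ^ 2 := by positivity
        linarith
      · rw [integral_const_mul]
        simp only [← h.coe τ hτ]
        have := integral_norm_sq_le (hM τ hτ)
        gcongr)
  refine ⟨?_, ?_⟩
  · have h1 : IntervalIntegrable (fun τ => ((4 * power (S τ) : ℝ) : ℂ)) volume s t := by
      refine key.1.congr fun τ hτ => ?_
      rw [Set.uIoc_of_le hst] at hτ
      exact h_int τ (Set.Ioc_subset_Icc_self hτ)
    have h2 : IntervalIntegrable (fun τ => 4 * power (S τ)) volume s t := by
      rw [intervalIntegrable_iff] at h1 ⊢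
      exact h1.re
    simpa using h2.const_mul (1 / 4)
  · have h1 := key.2
    rw [hqe t ⟨hst, le_rfl⟩, hqe s ⟨le_rfl, hst⟩] at h1
    have h2 : ∫ τ in s..t, ∫ x, ((4 * ‖u τ x‖ ^ 2 * inner ℝ (u τ x) (dt u τ x) : ℝ) : ℂ)
        = ∫ τ in s..t, ((4 * power (S τ) : ℝ) : ℂ) := by
      refine intervalIntegral.integral_congr fun τ hτ => ?_
      rw [Set.uIcc_of_le hst] at hτ
      exact h_int τ hτ
    rw [h2, intervalIntegral.integral_ofReal] at h1
    exact_mod_cast h1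

theorem IsFlowOn.kin_sub (h : IsFlowOn s t u S) (hst : s ≤ t)
    (hM : ∀ τ ∈ Set.Icc s t, FourierDecay M (S τ)) :
    kin (S t) - kin (S s) = ∫ τ in s..t, -2 * power (S τ) := by
  refine (intervalIntegral.integral_eq_sub_of_hasDerivAt_of_le hst (f := fun τ => kin (S τ))
    ?_ (fun τ hτ => ?_) ((h.quart_sub hst hM).1.const_mul (-2))).symm
  · refine continuousOn_of_dominated (bound := fun ξ => 4 * π ^ 2 * M ^ 2 * ((1 + ‖ξ‖) ^ 10)⁻¹)
      (fun τ _ => (integrable_kin (S τ)).1)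
      (fun τ hτ => Filter.Eventually.of_forall fun ξ => ?_)
      ((integrable_inv_one_add_norm_pow (by norm_num)).const_mul _)
      (Filter.Eventually.of_forall fun ξ =>
        continuousOn_const.mul ((h.continuousOn_fourier hM ξ).norm.pow 2))
    rw [Real.norm_of_nonneg (by positivity)]
    exact kin_integrand_le (hM τ hτ) ξ
  · rw [← integral_kin_deriv]
    have hmem : Set.Ioo s t ∈ nhds τ := Ioo_mem_nhds hτ.1 hτ.2
    refine (hasDerivAt_integral_of_dominated_loc_of_deriv_le (μ := volume)
      (F := fun τ ξ => (1 + 4 * π ^ 2 * ‖ξ‖ ^ 2) * ‖𝓕 (S τ : Plane → ℂ) ξ‖ ^ 2)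
      (F' := fun τ ξ => (1 + 4 * π ^ 2 * ‖ξ‖ ^ 2) *
        (2 * inner ℝ (𝓕 (S τ : Plane → ℂ) ξ) (𝓕 (rhsS (S τ) : Plane → ℂ) ξ)))
      (bound := fun ξ => 8 * π ^ 2 * M * rhsBound M * ((1 + ‖ξ‖) ^ 8)⁻¹) hmem
      (Filter.Eventually.of_forall fun τ => (integrable_kin (S τ)).1) (integrable_kin (S τ)) ?_
      (Filter.Eventually.of_forall fun ξ σ hσ => ?_)
      ((integrable_inv_one_add_norm_pow (by norm_num)).const_mul _)
      (Filter.Eventually.of_forall fun ξ σ hσ => ?_)).2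
    · have h1 := (S τ).fourier_continuous
      have h2 := (rhsS (S τ)).fourier_continuous
      exact (by fun_prop : Continuous _).aestronglyMeasurable
    · exact kin_deriv_integrand_le (hM σ (Set.Ioo_subset_Icc_self hσ)) ξ
    · exact ((h.hasDerivAt_fourier hM ξ hσ).norm_sq).const_mul _

theorem IsFlowOn.energy_eq (h : IsFlowOn s t u S) (hst : s ≤ t)
    (hM : ∀ τ ∈ Set.Icc s t, FourierDecay M (S τ)) :
    kin (S t) + quart (S t) / 2 = kin (S s) + quart (S s) / 2 := by
  have h1 := (h.quart_sub hst hM).2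
  have h2 := h.kin_sub hst hM
  rw [intervalIntegral.integral_const_mul] at h1 h2
  linarith

end Flow

/-- The area of the unit disc. -/
def ballVolume : ℝ := volume.real (Metric.ball (0 : Plane) 1)

theorem ballVolume_pos : 0 < ballVolume :=
  ENNReal.toReal_pos (Metric.measure_ball_pos volume _ one_pos).ne' measure_ball_lt_top.ne

theorem integral_ball_inv_one_add_sq {R : ℝ} (hR : 0 ≤ R) :
    ∫ ξ : Plane, (if ‖ξ‖ ≤ R then (1 + ‖ξ‖ ^ 2)⁻¹ else 0)
      = ballVolume * Real.log (1 + R ^ 2) := by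
  have h := integral_fun_norm_addHaar (E := Plane) volume
    (fun y : ℝ => if y ≤ R then (1 + y ^ 2)⁻¹ else 0)
  rw [h]
  have h1 : ∫ y in Set.Ioi (0 : ℝ), y ^ (Module.finrank ℝ Plane - 1) •
      (if y ≤ R then (1 + y ^ 2)⁻¹ else 0) = ∫ y in (0 : ℝ)..R, y * (1 + y ^ 2)⁻¹ := by
    rw [intervalIntegral.integral_of_le hR]
    have : ∀ y : ℝ, y ^ (Module.finrank ℝ Plane - 1) • (if y ≤ R then (1 + y ^ 2)⁻¹ else 0)
        = (Set.Iic R).indicator (fun y => y * (1 + y ^ 2)⁻¹) y := fun y => by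
      by_cases hy : y ≤ R <;> simp [hy]
    simp only [this]
    rw [setIntegral_indicator measurableSet_Iic, Set.Ioi_inter_Iic]
  have h2 : ∫ y in (0 : ℝ)..R, y * (1 + y ^ 2)⁻¹ = Real.log (1 + R ^ 2) / 2 := by
    rw [intervalIntegral.integral_eq_sub_of_hasDerivAt
      (f := fun y => Real.log (1 + y ^ 2) / 2) (f' := fun y => y * (1 + y ^ 2)⁻¹)]
    · simp
    · intro y _
      have hd := (((hasDerivAt_id y).pow 2).const_add 1).log (by positivity : (1 : ℝ) + y ^ 2 ≠ 0)
      refine (hd.div_const 2).congr_deriv ?_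
      simp
      field_simp
    · refine Continuous.intervalIntegrable ?_ _ _
      exact continuous_id.mul ((by fun_prop : Continuous fun y : ℝ => 1 + y ^ 2).inv₀
        fun y => by positivity)
  rw [h1, h2, ballVolume]
  simp
  ring

/-- The constant of the logarithmic Sobolev embedding `wienerNorm_sq_le`. -/
def logConst : ℝ := 2 * ballVolume + weightIntegral

theorem one_le_one_add_log {Y : ℝ} (hY : 0 ≤ Y) : 1 ≤ 1 + Real.log (2 + Y) := by
  have := Real.log_nonneg (by linarith : 1 ≤ 2 + Y)
  linarith

/-- A logarithmic Sobolev embedding: the Wiener norm is controlled by the energy and the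
logarithm of a stronger norm. -/
theorem wienerNorm_sq_le {Y B : ℝ} {f : 𝓢(Plane, ℂ)} (hY : FourierDecay Y f) (hB : kin f ≤ B) :
    wienerNorm f ^ 2 ≤ (B + logConst) ^ 2 * (1 + Real.log (2 + Y)) := by
  have hY0 := hY.nonneg
  set ℓ := 1 + Real.log (2 + Y) with hℓ
  have hℓ1 : 1 ≤ ℓ := one_le_one_add_log hY0
  set r := √ℓ with hr
  have hr1 : 1 ≤ r := Real.one_le_sqrt.2 hℓ1
  have hr0 : 0 < r := by linarith
  have hrr : r * r = ℓ := Real.mul_self_sqrt (by linarith)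
  set R := 1 + Y with hR
  set J : Plane → ℝ := fun ξ => if ‖ξ‖ ≤ R then (1 + ‖ξ‖ ^ 2)⁻¹ else 0 with hJ
  have hJi : Integrable J := by
    refine Integrable.of_integral_ne_zero ?_
    rw [hJ, integral_ball_inv_one_add_sq (by linarith)]
    have h1 := ballVolume_pos
    have h2 : 0 < Real.log (1 + R ^ 2) := Real.log_pos (by nlinarith)
    positivity
  have hJ0 : ∀ ξ, 0 ≤ J ξ := fun ξ => by
    simp only [hJ]; split_ifs <;> positivity
  have hpt : ∀ ξ, ‖𝓕 (f : Plane → ℂ) ξ‖ ≤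
      r * ((1 + 4 * π ^ 2 * ‖ξ‖ ^ 2) * ‖𝓕 (f : Plane → ℂ) ξ‖ ^ 2) + r⁻¹ * J ξ
        + ((1 + ‖ξ‖) ^ 4)⁻¹ := by
    intro ξ
    set a := ‖𝓕 (f : Plane → ℂ) ξ‖ with ha
    by_cases hξ : ‖ξ‖ ≤ R
    · have h1 : J ξ = (1 + ‖ξ‖ ^ 2)⁻¹ := by simp only [hJ, if_pos hξ]
      have hpi : 1 ≤ 4 * π ^ 2 := by nlinarith [Real.two_le_pi]
      have h3 : (1 + ‖ξ‖ ^ 2) * a ^ 2 ≤ (1 + 4 * π ^ 2 * ‖ξ‖ ^ 2) * a ^ 2 := by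
        have : ‖ξ‖ ^ 2 ≤ 4 * π ^ 2 * ‖ξ‖ ^ 2 := le_mul_of_one_le_left (by positivity) hpi
        gcongr
      have h4 : a ≤ r * ((1 + ‖ξ‖ ^ 2) * a ^ 2) + r⁻¹ * (1 + ‖ξ‖ ^ 2)⁻¹ := by
        set g := r * (1 + ‖ξ‖ ^ 2) with hg
        have hg0 : 0 < g := by positivity
        have e : r * ((1 + ‖ξ‖ ^ 2) * a ^ 2) + r⁻¹ * (1 + ‖ξ‖ ^ 2)⁻¹ = g * a ^ 2 + g⁻¹ := by
          rw [hg, mul_inv]; ring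
        rw [e]
        have : g * a ^ 2 + g⁻¹ - a = g⁻¹ * ((g * a - 1 / 2) ^ 2 + 3 / 4) := by
          field_simp
          ring
        have h5 : 0 ≤ g⁻¹ * ((g * a - 1 / 2) ^ 2 + 3 / 4) := by positivity
        linarith
      have h5 := mul_le_mul_of_nonneg_left h3 hr0.le
      have h6 : 0 ≤ ((1 + ‖ξ‖) ^ 4)⁻¹ := by positivity
      rw [h1]
      linarith
    · have h1 : a ≤ Y * ((1 + ‖ξ‖) ^ 6)⁻¹ := hY.norm_le ξ
      have h2 : Y * ((1 + ‖ξ‖) ^ 6)⁻¹ ≤ ((1 + ‖ξ‖) ^ 4)⁻¹ := by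
        push Not at hξ
        have h3 : Y ≤ (1 + ‖ξ‖) ^ 2 := by nlinarith
        rw [← div_eq_mul_inv, div_le_iff₀ (by positivity),
          show (1 + ‖ξ‖) ^ 6 = (1 + ‖ξ‖) ^ 4 * (1 + ‖ξ‖) ^ 2 by ring,
          inv_mul_cancel_left₀ (by positivity)]
        exact h3
      have h3 : 0 ≤ r * ((1 + 4 * π ^ 2 * ‖ξ‖ ^ 2) * a ^ 2) + r⁻¹ * J ξ := by
        have := hJ0 ξ
        positivity
      linarith
  have hi1 := (integrable_kin f).const_mul r
  have hi2 := hJi.const_mul r⁻¹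
  have hi3 := integrable_inv_one_add_norm_pow (k := 4) (by norm_num)
  have h_int : wienerNorm f ≤ r * kin f + r⁻¹ * (∫ ξ, J ξ) + weightIntegral := by
    calc wienerNorm f ≤ ∫ ξ, (r * ((1 + 4 * π ^ 2 * ‖ξ‖ ^ 2) * ‖𝓕 (f : Plane → ℂ) ξ‖ ^ 2)
          + r⁻¹ * J ξ + ((1 + ‖ξ‖) ^ 4)⁻¹) :=
        integral_mono f.fourier_integrable.norm ((hi1.add hi2).add hi3) hpt
      _ = _ := by
        have hi12 : Integrable fun ξ =>
            r * ((1 + 4 * π ^ 2 * ‖ξ‖ ^ 2) * ‖𝓕 (f : Plane → ℂ) ξ‖ ^ 2) + r⁻¹ * J ξ := hi1.add hi2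
        rw [integral_add hi12 hi3, integral_add hi1 hi2, integral_const_mul,
          integral_const_mul, kin, weightIntegral]
  have hJint : ∫ ξ, J ξ ≤ 2 * ballVolume * ℓ := by
    rw [hJ, integral_ball_inv_one_add_sq (by linarith)]
    have h1 : Real.log (1 + R ^ 2) ≤ Real.log ((2 + Y) ^ 2) :=
      Real.log_le_log (by positivity) (by nlinarith)
    rw [Real.log_pow] at h1
    have h2 : Real.log (1 + R ^ 2) ≤ 2 * ℓ := by push_cast at h1; linarith
    have h3 := ballVolume_pos
    nlinarith
  have hw : wienerNorm f ≤ r * (B + logConst) := by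
    refine h_int.trans ?_
    have h1 : r⁻¹ * ∫ ξ, J ξ ≤ 2 * ballVolume * r := by
      refine (mul_le_mul_of_nonneg_left hJint (by positivity)).trans (le_of_eq ?_)
      rw [← hrr]; field_simp
    have h2 : weightIntegral ≤ r * weightIntegral :=
      le_mul_of_one_le_left weightIntegral_nonneg hr1
    have h3 := mul_le_mul_of_nonneg_left hB hr0.le
    unfold logConst
    linarith
  calc wienerNorm f ^ 2 ≤ (r * (B + logConst)) ^ 2 :=
        pow_le_pow_left₀ (wienerNorm_nonneg _) hw 2
    _ = _ := by rw [mul_pow, mul_comm, sq r, hrr]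

/-- A logarithmic Gronwall inequality. -/
theorem one_add_log_le_of_le_integral {a b c : ℝ} {y : ℝ → ℝ} (hab : a ≤ b) (hc : 0 ≤ c)
    (hy : ContinuousOn y (Set.Icc a b)) (hy0 : ∀ τ ∈ Set.Icc a b, 0 ≤ y τ)
    (h : ∀ τ ∈ Set.Icc a b, y τ ≤ y a + ∫ σ in a..τ, c * ((1 + Real.log (2 + y σ)) * y σ)) :
    1 + Real.log (2 + y b) ≤ (1 + Real.log (2 + y a)) * rexp (c * (b - a)) := by
  have ha : a ∈ Set.Icc a b := ⟨le_rfl, hab⟩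
  have hb : b ∈ Set.Icc a b := ⟨hab, le_rfl⟩
  set g : ℝ → ℝ := fun σ => c * ((1 + Real.log (2 + y σ)) * y σ) with hg
  have hgc : ContinuousOn g (Set.Icc a b) := by
    refine continuousOn_const.mul ((continuousOn_const.add ?_).mul hy)
    exact (continuousOn_const.add hy).log fun τ hτ =>
      (show (0 : ℝ) < 2 + y τ by linarith [hy0 τ hτ]).ne'
  have hg0 : ∀ τ ∈ Set.Icc a b, 0 ≤ g τ := fun τ hτ => by
    have h1 := one_le_one_add_log (hy0 τ hτ)
    have h2 := hy0 τ hτ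
    simp only [hg]
    positivity
  set Y : ℝ → ℝ := fun τ => y a + ∫ σ in a..τ, g σ with hY
  have hgi : ∀ τ ∈ Set.Icc a b, IntervalIntegrable g volume a τ := fun τ hτ =>
    (hgc.mono (Set.Icc_subset_Icc_right hτ.2)).intervalIntegrable_of_Icc hτ.1
  have hYc : ContinuousOn Y (Set.Icc a b) := by
    refine continuousOn_const.add ?_
    have := intervalIntegral.continuousOn_primitive_interval
      (f := g) (μ := volume) (a := a) (b := b) (by
        rw [Set.uIcc_of_le hab]; exact hgc.integrableOn_Icc)
    rwa [Set.uIcc_of_le hab] at this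
  have hYd : ∀ τ ∈ Set.Ioo a b, HasDerivAt Y (g τ) τ := fun τ hτ => by
    have hnhds : Set.Icc a b ∈ nhds τ := Icc_mem_nhds hτ.1 hτ.2
    refine (intervalIntegral.integral_hasDerivAt_right (hgi τ (Set.Ioo_subset_Icc_self hτ))
      ?_ (hgc.continuousAt hnhds)).const_add _
    have := hgc.stronglyMeasurableAtFilter_nhdsWithin measurableSet_Icc τ (μ := volume)
    rwa [nhdsWithin_eq_nhds.2 hnhds] at this
  have hyY : ∀ τ ∈ Set.Icc a b, y τ ≤ Y τ := h
  have hY0 : ∀ τ ∈ Set.Icc a b, 0 ≤ Y τ := fun τ hτ => (hy0 τ hτ).trans (hyY τ hτ)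
  have hlog : ∀ τ ∈ Set.Icc a b, 1 ≤ 1 + Real.log (2 + Y τ) := fun τ hτ =>
    one_le_one_add_log (hY0 τ hτ)
  have hanti : AntitoneOn (fun τ => Real.log (1 + Real.log (2 + Y τ)) - c * τ)
      (Set.Icc a b) := by
    refine antitoneOn_of_hasDerivWithinAt_nonpos (convex_Icc a b)
      (f' := fun τ => g τ / (2 + Y τ) / (1 + Real.log (2 + Y τ)) - c) ?_ ?_ ?_
    · refine ContinuousOn.sub (ContinuousOn.log (continuousOn_const.add
        ((continuousOn_const.add hYc).log ?_)) ?_) (by fun_prop)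
      · exact fun τ hτ => (show (0 : ℝ) < 2 + Y τ by linarith [hY0 τ hτ]).ne'
      · exact fun τ hτ => (show (0 : ℝ) < 1 + Real.log (2 + Y τ) by linarith [hlog τ hτ]).ne'
    · intro τ hτ
      rw [interior_Icc] at hτ
      have h1 := hY0 τ (Set.Ioo_subset_Icc_self hτ)
      have h2 := hlog τ (Set.Ioo_subset_Icc_self hτ)
      have hd := ((((hYd τ hτ).const_add 2).log (by positivity)).const_add 1).log (by positivity)
      have hd2 := hd.sub ((hasDerivAt_id τ).const_mul c)
      rw [mul_one] at hd2
      exact hd2.hasDerivWithinAt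
    · intro τ hτ
      rw [interior_Icc] at hτ
      have hτ' := Set.Ioo_subset_Icc_self hτ
      have h0 := hy0 τ hτ'
      have h1 := hY0 τ hτ'
      have h2 := hlog τ hτ'
      have h3 := hyY τ hτ'
      rw [sub_nonpos, div_div, div_le_iff₀ (by positivity)]
      have h4 := one_le_one_add_log h0
      have h5 : Real.log (2 + y τ) ≤ Real.log (2 + Y τ) :=
        Real.log_le_log (by positivity) (by linarith)
      calc g τ = c * ((1 + Real.log (2 + y τ)) * y τ) := rfl
        _ ≤ c * ((1 + Real.log (2 + Y τ)) * (2 + Y τ)) := by gcongr; linarith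
        _ = _ := by ring
  have key := hanti ha hb hab
  have hYa : Y a = y a := by simp [hY]
  simp only [hYa] at key
  have h1 := hlog b hb
  have h2 := one_le_one_add_log (hy0 a ha)
  have h3 : Real.log (1 + Real.log (2 + Y b))
      ≤ Real.log (1 + Real.log (2 + y a)) + c * (b - a) := by linarith
  rw [Real.log_le_iff_le_exp (by positivity), Real.exp_add, Real.exp_log (by positivity)] at h3
  refine le_trans ?_ h3
  have h4 := hy0 b hb
  have := Real.log_le_log (by positivity) (by linarith [hyY b hb] : 2 + y b ≤ 2 + Y b)
  linarith

/-- The best constant in `FourierDecay`. -/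
def decayNorm (f : 𝓢(Plane, ℂ)) : ℝ := ⨆ ξ, (1 + ‖ξ‖) ^ 6 * ‖𝓕 (f : Plane → ℂ) ξ‖

theorem fourierDecay_decayNorm (f : 𝓢(Plane, ℂ)) : FourierDecay (decayNorm f) f := by
  obtain ⟨M, hM⟩ := exists_fourierDecay f
  exact fun ξ => le_ciSup (f := fun ξ => (1 + ‖ξ‖) ^ 6 * ‖𝓕 (f : Plane → ℂ) ξ‖)
    ⟨M, by rintro _ ⟨ξ, rfl⟩; exact hM ξ⟩ ξ

theorem decayNorm_nonneg (f : 𝓢(Plane, ℂ)) : 0 ≤ decayNorm f := (fourierDecay_decayNorm f).nonneg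

theorem decayNorm_le {M : ℝ} {f : 𝓢(Plane, ℂ)} (h : FourierDecay M f) : decayNorm f ≤ M :=
  ciSup_le h

theorem decayNorm_le_add {D : ℝ} {f g : 𝓢(Plane, ℂ)}
    (h : ∀ ξ, (1 + ‖ξ‖) ^ 6 * ‖𝓕 (f : Plane → ℂ) ξ‖
      ≤ (1 + ‖ξ‖) ^ 6 * ‖𝓕 (g : Plane → ℂ) ξ‖ + D) : decayNorm f ≤ decayNorm g + D :=
  ciSup_le fun ξ => (h ξ).trans (add_le_add_left (fourierDecay_decayNorm g ξ) D)

/-- An upper bound for the energy in terms of the Fourier decay. -/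
def energyBound (m : ℝ) : ℝ :=
  4 * π ^ 2 * m ^ 2 * weightIntegral + (m * weightIntegral) ^ 2 * (m ^ 2 * weightIntegral)

/-- The growth rate of the Fourier decay constant. -/
def growthRate (m : ℝ) : ℝ := 2080 * (energyBound m + logConst) ^ 2

/-- The a priori bound for the Fourier decay constant after time `L`. -/
def growthBound (L m : ℝ) : ℝ := rexp ((1 + Real.log (2 + m)) * rexp (growthRate m * L))

section Flow

variable {s t M : ℝ} {u : ℝ → Plane → ℂ} {S : ℝ → 𝓢(Plane, ℂ)}

theorem IsFlowOn.abs_decay_sub_le (h : IsFlowOn s t u S)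
    (hM : ∀ τ ∈ Set.Icc s t, FourierDecay M (S τ)) (ξ : Plane) {a b : ℝ}
    (ha : a ∈ Set.Icc s t) (hb : b ∈ Set.Icc s t) (hab : a ≤ b) {g : ℝ → ℝ}
    (hg : IntervalIntegrable g volume a b)
    (hgb : ∀ τ ∈ Set.Icc a b, FourierDecay (g τ) (cubicS (S τ))) :
    |(1 + ‖ξ‖) ^ 6 * ‖𝓕 (S b : Plane → ℂ) ξ‖ - (1 + ‖ξ‖) ^ 6 * ‖𝓕 (S a : Plane → ℂ) ξ‖|
      ≤ ∫ τ in a..b, g τ := by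
  rw [← mul_sub, abs_mul, abs_of_nonneg (by positivity : 0 ≤ (1 + ‖ξ‖) ^ 6)]
  refine (mul_le_mul_of_nonneg_left (h.abs_norm_fourier_sub_le hM ξ ha hb hab)
    (by positivity)).trans ?_
  rw [← intervalIntegral.integral_const_mul]
  refine intervalIntegral.integral_mono_on hab ?_ hg fun τ hτ => hgb τ hτ ξ
  exact (((h.continuousOn_fourier_cubicS hM ξ).mono (Set.Icc_subset_Icc ha.1 hb.2)).norm
    |>.intervalIntegrable_of_Icc hab).const_mul _

theorem IsFlowOn.abs_decayNorm_sub_le (h : IsFlowOn s t u S)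
    (hM : ∀ τ ∈ Set.Icc s t, FourierDecay M (S τ)) {a b : ℝ}
    (ha : a ∈ Set.Icc s t) (hb : b ∈ Set.Icc s t) (hab : a ≤ b) {g : ℝ → ℝ}
    (hg : IntervalIntegrable g volume a b)
    (hgb : ∀ τ ∈ Set.Icc a b, FourierDecay (g τ) (cubicS (S τ))) :
    |decayNorm (S b) - decayNorm (S a)| ≤ ∫ τ in a..b, g τ := by
  have key := fun ξ => abs_sub_le_iff.1 (h.abs_decay_sub_le hM ξ ha hb hab hg hgb)
  have h1 := decayNorm_le_add (f := S b) (g := S a) (D := ∫ τ in a..b, g τ)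
    fun ξ => by linarith [(key ξ).1]
  have h2 := decayNorm_le_add (f := S a) (g := S b) (D := ∫ τ in a..b, g τ)
    fun ξ => by linarith [(key ξ).2]
  exact abs_sub_le_iff.2 ⟨by linarith, by linarith⟩

theorem IsFlowOn.continuousOn_decayNorm (h : IsFlowOn s t u S)
    (hM : ∀ τ ∈ Set.Icc s t, FourierDecay M (S τ)) :
    ContinuousOn (fun τ => decayNorm (S τ)) (Set.Icc s t) := by
  set D := 2080 * (M * weightIntegral) ^ 2 * M with hD
  have hgb : ∀ τ ∈ Set.Icc s t, FourierDecay D (cubicS (S τ)) := fun τ hτ => by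
    refine (fourierDecay_cubicS (hM τ hτ)).mono ?_
    have h1 := wienerNorm_nonneg (S τ)
    have h2 := wienerNorm_le_of_decay (hM τ hτ)
    have h3 := (hM τ hτ).nonneg
    rw [hD]
    gcongr
  refine LipschitzOnWith.continuousOn (K := D.toNNReal)
    (LipschitzOnWith.of_dist_le_mul fun b hb a ha => ?_)
  rw [Real.dist_eq, Real.dist_eq, Real.coe_toNNReal _ (hgb a ha).nonneg]
  wlog hab : a ≤ b generalizing a b
  · rw [abs_sub_comm, abs_sub_comm b a]
    exact this a ha b hb (le_of_not_ge hab)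
  refine (h.abs_decayNorm_sub_le hM ha hb hab (g := fun _ => D) intervalIntegrable_const
    fun τ hτ => hgb τ ⟨ha.1.trans hτ.1, hτ.2.trans hb.2⟩).trans (le_of_eq ?_)
  rw [intervalIntegral.integral_const, abs_of_nonneg (sub_nonneg.2 hab), smul_eq_mul, mul_comm]

theorem IsFlowOn.kin_le_energyBound (h : IsFlowOn s t u S)
    (hM : ∀ τ ∈ Set.Icc s t, FourierDecay M (S τ)) {m σ τ : ℝ}
    (hσ : σ ∈ Set.Icc s t) (hτ : τ ∈ Set.Icc s t) (hm : FourierDecay m (S σ)) :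
    kin (S τ) ≤ energyBound m := by
  have h1 : kin (S τ) + quart (S τ) / 2 = kin (S σ) + quart (S σ) / 2 := by
    rcases le_total σ τ with hle | hle
    · exact (h.mono hσ.1 hτ.2).energy_eq hle fun ρ hρ => hM ρ ⟨hσ.1.trans hρ.1, hρ.2.trans hτ.2⟩
    · exact ((h.mono hτ.1 hσ.2).energy_eq hle fun ρ hρ =>
        hM ρ ⟨hτ.1.trans hρ.1, hρ.2.trans hσ.2⟩).symm
  have h2 := kin_le hm
  have h3 := quart_le hm
  have h4 := quart_nonneg (S τ)
  have h5 := quart_nonneg (S σ)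
  unfold energyBound
  linarith

/-- Persistence of Fourier decay, with a bound depending only on the decay at one time and
on the length of the interval. -/
theorem IsFlowOn.fourierDecay_growthBound (h : IsFlowOn s t u S)
    (hM : ∀ τ ∈ Set.Icc s t, FourierDecay M (S τ)) {L m σ τ : ℝ} (hL : t - s ≤ L)
    (hσ : σ ∈ Set.Icc s t) (hτ : τ ∈ Set.Icc s t) (hm : FourierDecay m (S σ)) :
    FourierDecay (growthBound L m) (S τ) := by
  set y : ℝ → ℝ := fun τ => decayNorm (S τ) with hy
  have hyc : ContinuousOn y (Set.Icc s t) := h.continuousOn_decayNorm hM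
  have hy0 : ∀ τ, 0 ≤ y τ := fun τ => decayNorm_nonneg _
  have hc : 0 ≤ growthRate m := by unfold growthRate; positivity
  set c := growthRate m with hcd
  set g : ℝ → ℝ := fun σ => c * ((1 + Real.log (2 + y σ)) * y σ) with hg
  have hgc : ContinuousOn g (Set.Icc s t) := by
    refine continuousOn_const.mul ((continuousOn_const.add ?_).mul hyc)
    exact (continuousOn_const.add hyc).log fun τ hτ =>
      (show (0 : ℝ) < 2 + y τ by linarith [hy0 τ]).ne'
  have hgb : ∀ ρ ∈ Set.Icc s t, FourierDecay (g ρ) (cubicS (S ρ)) := fun ρ hρ => by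
    refine (fourierDecay_cubicS (fourierDecay_decayNorm (S ρ))).mono ?_
    have h1 := wienerNorm_sq_le (fourierDecay_decayNorm (S ρ)) (h.kin_le_energyBound hM hσ hρ hm)
    calc 2080 * wienerNorm (S ρ) ^ 2 * decayNorm (S ρ)
        ≤ 2080 * ((energyBound m + logConst) ^ 2 * (1 + Real.log (2 + decayNorm (S ρ))))
          * decayNorm (S ρ) := by
          have := decayNorm_nonneg (S ρ)
          gcongr
      _ = g ρ := by simp only [hg, hcd, growthRate, hy]; ring
  have hdiff : ∀ {a b : ℝ}, a ∈ Set.Icc s t → b ∈ Set.Icc s t → a ≤ b →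
      |y b - y a| ≤ ∫ ρ in a..b, g ρ := fun {a b} ha hb hab =>
    h.abs_decayNorm_sub_le hM ha hb hab
      ((hgc.mono (Set.Icc_subset_Icc ha.1 hb.2)).intervalIntegrable_of_Icc hab)
      fun ρ hρ => hgb ρ ⟨ha.1.trans hρ.1, hρ.2.trans hb.2⟩
  have hst : |τ - σ| ≤ t - s := by
    rw [abs_sub_le_iff]; constructor <;> linarith [hσ.1, hσ.2, hτ.1, hτ.2]
  have key : 1 + Real.log (2 + y τ) ≤ (1 + Real.log (2 + y σ)) * rexp (c * |τ - σ|) := by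
    rcases le_total σ τ with hle | hle
    · rw [abs_of_nonneg (sub_nonneg.2 hle)]
      refine one_add_log_le_of_le_integral hle hc (hyc.mono (Set.Icc_subset_Icc hσ.1 hτ.2))
        (fun ρ _ => hy0 ρ) fun ρ hρ => ?_
      have := (abs_sub_le_iff.1 (hdiff hσ ⟨hσ.1.trans hρ.1, hρ.2.trans hτ.2⟩ hρ.1)).1
      simp only [hg] at this
      linarith
    · rw [abs_sub_comm, abs_of_nonneg (sub_nonneg.2 hle)]
      have hneg := one_add_log_le_of_le_integral (y := fun ρ => y (-ρ)) (a := -σ) (b := -τ)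
        (neg_le_neg hle) hc
        (hyc.comp continuousOn_neg fun ρ hρ =>
          ⟨by linarith [hρ.2, hτ.1], by linarith [hρ.1, hσ.2]⟩)
        (fun ρ _ => hy0 _) (fun ρ hρ => by
          have hρ1 : -ρ ≤ σ := by linarith [hρ.1]
          have hρ2 : -ρ ∈ Set.Icc s t := ⟨by linarith [hρ.2, hτ.1], by linarith [hρ.1, hσ.2]⟩
          have := (abs_sub_le_iff.1 (hdiff hρ2 hσ hρ1)).2
          have e := intervalIntegral.integral_comp_neg (a := -σ) (b := ρ) g
          rw [neg_neg] at e
          rw [← e] at this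
          simp only [hg] at this
          rw [neg_neg]
          linarith)
      simp only [neg_neg] at hneg
      rwa [show -τ - -σ = σ - τ by ring] at hneg
  have hym : y σ ≤ m := decayNorm_le hm
  have h1 : Real.log (2 + y σ) ≤ Real.log (2 + m) :=
    Real.log_le_log (by linarith [hy0 σ]) (by linarith)
  have h2 := one_le_one_add_log hm.nonneg
  have h3 : 1 + Real.log (2 + y τ) ≤ (1 + Real.log (2 + m)) * rexp (c * L) := by
    refine key.trans ?_
    have := hst.trans hL
    gcongr
  refine (fourierDecay_decayNorm (S τ)).mono ?_
  have h4 : Real.log (2 + y τ) ≤ (1 + Real.log (2 + m)) * rexp (c * L) := by linarith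
  rw [Real.log_le_iff_le_exp (by linarith [hy0 τ])] at h4
  change y τ ≤ rexp ((1 + Real.log (2 + m)) * rexp (c * L))
  linarith

end Flow

section Baire

/-- If each point of a compact set has a neighbourhood on which `y` is bounded above, then `y` is
bounded above on the set. -/
theorem exists_le_of_forall_nhdsWithin {X : Type*} [TopologicalSpace X] {A E : Set X} {y : X → ℝ}
    (hA : IsCompact A) (hAE : A ⊆ E)
    (h : ∀ x ∈ A, ∃ V ∈ nhdsWithin x E, ∃ M, ∀ z ∈ V, y z ≤ M) : ∃ M, ∀ x ∈ A, y x ≤ M := by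
  refine hA.induction_on (p := fun B => ∃ M, ∀ x ∈ B, y x ≤ M) ⟨0, by simp⟩
    (fun B B' hB ⟨M, hM⟩ => ⟨M, fun x hx => hM x (hB hx)⟩)
    (fun B B' ⟨M, hM⟩ ⟨M', hM'⟩ => ⟨max M M', ?_⟩) fun x hx => ?_
  · rintro x (hx | hx)
    · exact (hM x hx).trans (le_max_left _ _)
    · exact (hM' x hx).trans (le_max_right _ _)
  · obtain ⟨V, hV, hM⟩ := h x hx
    exact ⟨V, nhdsWithin_mono x hAE hV, hM⟩

/-- A Baire category argument: a function which is bounded on each of countably many closed sets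
covering an interval, and which satisfies an a priori bound on every subinterval on which it is
bounded, is bounded. -/
theorem exists_le_of_baire {a b : ℝ} {y G : ℝ → ℝ} {C : ℕ → Set ℝ} {c : ℕ → ℝ}
    (hC : ∀ n, IsClosed (C n)) (hcov : ∀ τ ∈ Set.Icc a b, ∃ n, τ ∈ C n)
    (hc : ∀ n, ∀ τ ∈ Set.Icc a b, τ ∈ C n → y τ ≤ c n)
    (hG : ∀ p q, a ≤ p → q ≤ b → (∃ M, ∀ τ ∈ Set.Icc p q, y τ ≤ M) →
      ∀ σ ∈ Set.Icc p q, ∀ m, y σ ≤ m → ∀ τ ∈ Set.Icc p q, y τ ≤ G m) :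
    ∃ M, ∀ τ ∈ Set.Icc a b, y τ ≤ M := by
  set E := Set.Icc a b with hE
  set U : Set ℝ := {τ | ∃ V ∈ nhdsWithin τ E, ∃ M, ∀ z ∈ V, y z ≤ M} with hU
  have hbdd : ∀ p q, a ≤ p → q ≤ b → Set.Icc p q ⊆ U → ∃ M, ∀ τ ∈ Set.Icc p q, y τ ≤ M :=
    fun p q hp hq hpq => exists_le_of_forall_nhdsWithin isCompact_Icc
      (Set.Icc_subset_Icc hp hq) fun x hx => hpq hx
  have hUo : IsOpen U := by
    rw [isOpen_iff_mem_nhds]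
    rintro τ ⟨V, hV, M, hM⟩
    obtain ⟨O, hO, hτO, hOV⟩ := mem_nhdsWithin.1 hV
    refine Filter.mem_of_superset (hO.mem_nhds hτO) fun z hz => ⟨O ∩ E, ?_, M, fun w hw =>
      hM w (hOV hw)⟩
    exact mem_nhdsWithin.2 ⟨O, hO, hz, subset_rfl⟩
  by_cases hEU : E ⊆ U
  · exact hbdd a b le_rfl le_rfl hEU
  exfalso
  set K : Set ℝ := E \ U with hK
  have hKc : IsClosed K := isClosed_Icc.sdiff hUo
  have hKn : K.Nonempty := Set.not_subset.1 hEU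
  have : CompleteSpace K := hKc.completeSpace_coe
  have : Nonempty K := hKn.to_subtype
  obtain ⟨n, t₀, ht₀⟩ := nonempty_interior_of_iUnion_of_closed
    (f := fun n => (Subtype.val ⁻¹' C n : Set K))
    (fun n => (hC n).preimage continuous_subtype_val) (Set.eq_univ_of_forall fun x => by
      obtain ⟨n, hn⟩ := hcov x x.2.1
      exact Set.mem_iUnion.2 ⟨n, hn⟩)
  obtain ⟨ε, hε, hball⟩ := Metric.mem_nhds_iff.1 (mem_interior_iff_mem_nhds.1 ht₀)
  have hKC : ∀ τ ∈ K, |τ - t₀| < ε → y τ ≤ c n := fun τ hτ hd =>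
    hc n τ hτ.1 (hball (show (⟨τ, hτ⟩ : K) ∈ Metric.ball t₀ ε by
      rw [Metric.mem_ball, Subtype.dist_eq, Real.dist_eq]; exact hd))
  have hmem : (t₀ : ℝ) ∈ U := by
    refine ⟨Metric.ball (t₀ : ℝ) ε ∩ E, Filter.inter_mem
      (mem_nhdsWithin_of_mem_nhds (Metric.ball_mem_nhds _ hε)) self_mem_nhdsWithin,
      max (c n) (G (c n)), ?_⟩
    rintro τ ⟨hτb, hτE⟩
    rw [Metric.mem_ball, Real.dist_eq] at hτb
    by_cases hτK : τ ∈ K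
    · exact (hKC τ hτK hτb).trans (le_max_left _ _)
    refine le_trans ?_ (le_max_right _ _)
    rcases le_total τ t₀ with hle | hle
    · obtain ⟨d, ⟨hdK, hτd, hdt⟩, hleast⟩ := ((isCompact_Icc (a := τ) (b := (t₀ : ℝ))).inter_left
        hKc).exists_isLeast ⟨t₀, t₀.2, hle, le_rfl⟩
      have hd : y d ≤ c n := hKC d hdK (by
        rw [abs_sub_lt_iff] at hτb ⊢; constructor <;> linarith)
      have hlt : ∀ ρ ∈ Set.Icc τ d, ρ ≠ d → y ρ ≤ G (y τ) := fun ρ hρ hne => by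
        have hρd := lt_of_le_of_ne hρ.2 hne
        refine hG τ ρ hτE.1 (hρ.2.trans hdK.1.2) (hbdd τ ρ hτE.1 (hρ.2.trans hdK.1.2)
          fun z hz => ?_) τ ⟨le_rfl, hρ.1⟩ _ le_rfl ρ ⟨hρ.1, le_rfl⟩
        by_contra hzU
        have hzK : z ∈ K := ⟨⟨hτE.1.trans hz.1, (hz.2.trans hρ.2).trans hdK.1.2⟩, hzU⟩
        have := hleast ⟨hzK, hz.1, (hz.2.trans hρ.2).trans hdt⟩
        linarith [hz.2]
      refine hG τ d hτE.1 hdK.1.2 ⟨max (G (y τ)) (c n), fun ρ hρ => ?_⟩ d ⟨hτd, le_rfl⟩ _ hd τ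
        ⟨le_rfl, hτd⟩
      by_cases hρd : ρ = d
      · exact (hρd ▸ hd).trans (le_max_right _ _)
      · exact (hlt ρ hρ hρd).trans (le_max_left _ _)
    · obtain ⟨d, ⟨hdK, htd, hdτ⟩, hgr⟩ := ((isCompact_Icc (a := (t₀ : ℝ)) (b := τ)).inter_left
        hKc).exists_isGreatest ⟨t₀, t₀.2, le_rfl, hle⟩
      have hd : y d ≤ c n := hKC d hdK (by
        rw [abs_sub_lt_iff] at hτb ⊢; constructor <;> linarith)
      have hlt : ∀ ρ ∈ Set.Icc d τ, ρ ≠ d → y ρ ≤ G (y τ) := fun ρ hρ hne => by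
        have hρd := lt_of_le_of_ne hρ.1 (Ne.symm hne)
        refine hG ρ τ (hdK.1.1.trans hρ.1) hτE.2 (hbdd ρ τ (hdK.1.1.trans hρ.1) hτE.2
          fun z hz => ?_) τ ⟨hρ.2, le_rfl⟩ _ le_rfl ρ ⟨le_rfl, hρ.2⟩
        by_contra hzU
        have hzK : z ∈ K := ⟨⟨hdK.1.1.trans (hρ.1.trans hz.1), hz.2.trans hτE.2⟩, hzU⟩
        have := hgr ⟨hzK, (htd.trans hρ.1).trans hz.1, hz.2⟩
        linarith [hz.1]
      refine hG d τ hdK.1.1 hτE.2 ⟨max (G (y τ)) (c n), fun ρ hρ => ?_⟩ d ⟨le_rfl, hdτ⟩ _ hd τ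
        ⟨hdτ, le_rfl⟩
      by_cases hρd : ρ = d
      · exact (hρd ▸ hd).trans (le_max_right _ _)
      · exact (hlt ρ hρ hρd).trans (le_max_left _ _)
  exact t₀.2.2 hmem

end Baire

section Spatial

theorem contDiff_pd {u : ℝ → Plane → ℂ} (hu : ContDiff ℝ ∞ (Function.uncurry u)) (j : Fin 2) :
    ContDiff ℝ ∞ (Function.uncurry fun τ => pd j (u τ)) := by
  have h : (Function.uncurry fun τ => pd j (u τ)) = fun p : ℝ × Plane =>
      fderiv ℝ (Function.uncurry u) p ((0 : ℝ), EuclideanSpace.single j (1 : ℝ)) := by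
    ext ⟨τ, x⟩
    have h1 := (hu.differentiable (by simp) (τ, x)).hasFDerivAt
    have h2 : HasFDerivAt (fun x : Plane => (τ, x)) (ContinuousLinearMap.inr ℝ ℝ Plane) x :=
      hasFDerivAt_prodMk_right τ x
    have h3 : HasFDerivAt (u τ) ((fderiv ℝ (Function.uncurry u) (τ, x)).comp
      (ContinuousLinearMap.inr ℝ ℝ Plane)) x := h1.comp x h2
    simp only [Function.uncurry_apply_pair, pd, h3.fderiv]
    simp
  rw [h]
  exact (hu.fderiv_right (m := ∞) (by simp)).clm_apply contDiff_const

theorem contDiff_lap {u : ℝ → Plane → ℂ} (hu : ContDiff ℝ ∞ (Function.uncurry u)) :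
    ContDiff ℝ ∞ (Function.uncurry fun τ => lap (u τ)) := by
  have h : (Function.uncurry fun τ => lap (u τ)) = fun p : ℝ × Plane =>
      ∑ j, Function.uncurry (fun τ => pd j (pd j (u τ))) p := by
    ext ⟨τ, x⟩; simp [lap]
  rw [h]
  exact ContDiff.sum fun j _ => contDiff_pd (contDiff_pd hu j) j

theorem continuous_slice {u : ℝ → Plane → ℂ} (hu : ContDiff ℝ ∞ (Function.uncurry u)) (x : Plane) :
    Continuous fun τ => u τ x :=
  hu.continuous.comp (by fun_prop : Continuous fun τ : ℝ => (τ, x))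

theorem exists_pointwise_decay (f : 𝓢(Plane, ℂ)) : ∃ M, ∀ x, (1 + ‖x‖) ^ 3 * ‖f x‖ ≤ M := by
  refine ⟨2 ^ 3 * ((Finset.Iic ((3 : ℕ), (0 : ℕ))).sup
    fun m => SchwartzMap.seminorm ℝ m.1 m.2) f, fun x => ?_⟩
  have h := SchwartzMap.one_add_le_sup_seminorm_apply (𝕜 := ℝ) (m := (3, 0)) (k := 3) (n := 0)
    le_rfl le_rfl f x
  rwa [norm_iteratedFDeriv_zero] at h

theorem norm_fourier_le_of_pointwise {M : ℝ} {f : 𝓢(Plane, ℂ)}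
    (h : ∀ x, (1 + ‖x‖) ^ 3 * ‖f x‖ ≤ M) (ξ : Plane) :
    ‖𝓕 (f : Plane → ℂ) ξ‖ ≤ M * ∫ x : Plane, ((1 + ‖x‖) ^ 3)⁻¹ := by
  refine (VectorFourier.norm_fourierIntegral_le_integral_norm _ _ _ _ _).trans ?_
  rw [← integral_const_mul]
  refine integral_mono f.integrable.norm
    ((integrable_inv_one_add_norm_pow le_rfl).const_mul M) fun x => ?_
  simp only
  rw [← div_eq_mul_inv, le_div_iff₀ (by positivity)]
  linarith [h x]

theorem fourierDecay_of_pointwise {M : ℝ} {f : 𝓢(Plane, ℂ)}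
    (h : ∀ x, (1 + ‖x‖) ^ 3 * ‖f x‖ ≤ M)
    (h' : ∀ x, (1 + ‖x‖) ^ 3 * ‖lapS (lapS (lapS f)) x‖ ≤ M) :
    FourierDecay (64 * (M * ∫ x : Plane, ((1 + ‖x‖) ^ 3)⁻¹)) f := fun ξ => by
  set D := M * ∫ x : Plane, ((1 + ‖x‖) ^ 3)⁻¹
  have h1 := norm_fourier_le_of_pointwise h ξ
  have h2 := norm_fourier_le_of_pointwise h' ξ
  simp only [fourier_lapS, norm_mul, norm_neg, Complex.norm_real, norm_pow, norm_norm,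
    Real.norm_of_nonneg Real.pi_pos.le, Real.norm_ofNat] at h2
  set z := ‖𝓕 (f : Plane → ℂ) ξ‖
  have hz : 0 ≤ z := norm_nonneg _
  have hp : (1 : ℝ) ≤ 4 * π ^ 2 := by nlinarith [Real.pi_gt_three]
  have h3 : ‖ξ‖ ^ 6 * z ≤ D := by
    refine le_trans ?_ h2
    have : (1 : ℝ) ≤ (4 * π ^ 2) ^ 3 := one_le_pow₀ hp
    calc ‖ξ‖ ^ 6 * z = 1 * (‖ξ‖ ^ 6 * z) := by ring
      _ ≤ (4 * π ^ 2) ^ 3 * (‖ξ‖ ^ 6 * z) := by gcongr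
      _ = _ := by ring
  have h4 : (1 + ‖ξ‖) ^ 6 ≤ 32 * (1 + ‖ξ‖ ^ 6) := by
    have := add_pow_le (zero_le_one (α := ℝ)) (norm_nonneg ξ) 6
    norm_num at this
    linarith
  calc (1 + ‖ξ‖) ^ 6 * z ≤ 32 * (1 + ‖ξ‖ ^ 6) * z := by gcongr
    _ = 32 * z + 32 * (‖ξ‖ ^ 6 * z) := by ring
    _ ≤ 64 * D := by linarith

end Spatial

/-- A smooth, spatially Schwartz solution has uniform Fourier decay. -/
theorem IsFlowOn.exists_uniform_fourierDecay {T : ℝ} {u : ℝ → Plane → ℂ} {S : ℝ → 𝓢(Plane, ℂ)}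
    (h : IsFlowOn 0 T u S) : ∃ M, ∀ τ ∈ Set.Icc 0 T, FourierDecay M (S τ) := by
  set L : (ℝ → Plane → ℂ) → ℝ → Plane → ℂ := fun u τ => lap (u τ) with hL
  have hu := h.contDiff
  have hu3 : ContDiff ℝ ∞ (Function.uncurry (L (L (L u)))) :=
    contDiff_lap (contDiff_lap (contDiff_lap hu))
  have hcoe : ∀ τ ∈ Set.Icc 0 T, ⇑(S τ) = u τ := fun τ hτ => funext (h.coe τ hτ)
  have hcoe3 : ∀ τ ∈ Set.Icc 0 T, ∀ x, lapS (lapS (lapS (S τ))) x = L (L (L u)) τ x :=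
    fun τ hτ x => by rw [coe_lapS, coe_lapS, coe_lapS, hcoe τ hτ]
  set C : ℕ → Set ℝ := fun n => {τ | ∀ x, (1 + ‖x‖) ^ 3 * ‖u τ x‖ ≤ n ∧
    (1 + ‖x‖) ^ 3 * ‖L (L (L u)) τ x‖ ≤ n} with hC
  have hmain := exists_le_of_baire (a := 0) (b := T) (y := fun τ => decayNorm (S τ))
    (G := growthBound T) (C := C) (c := fun n => 64 * (n * ∫ x : Plane, ((1 + ‖x‖) ^ 3)⁻¹))
    (fun n => ?_) (fun τ hτ => ?_) (fun n τ hτ hn => ?_) fun p q hp hq ⟨M, hM⟩ σ hσ m hm τ hτ => ?_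
  · obtain ⟨M, hM⟩ := hmain
    exact ⟨M, fun τ hτ => (fourierDecay_decayNorm _).mono (hM τ hτ)⟩
  · simp only [hC, Set.ofPred_forall, Set.ofPred_and]
    refine isClosed_iInter fun x => IsClosed.inter ?_ ?_
    · exact isClosed_le (continuous_const.mul (continuous_slice hu x).norm) continuous_const
    · exact isClosed_le (continuous_const.mul (continuous_slice hu3 x).norm) continuous_const
  · obtain ⟨M, hM⟩ := exists_pointwise_decay (S τ)
    obtain ⟨M', hM'⟩ := exists_pointwise_decay (lapS (lapS (lapS (S τ))))
    obtain ⟨n, hn⟩ := exists_nat_ge (max M M')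
    refine ⟨n, fun x => ⟨?_, ?_⟩⟩
    · rw [← h.coe τ hτ]
      exact (hM x).trans ((le_max_left _ _).trans hn)
    · rw [← hcoe3 τ hτ]
      exact (hM' x).trans ((le_max_right _ _).trans hn)
  · refine decayNorm_le (fourierDecay_of_pointwise (fun x => ?_) fun x => ?_)
    · rw [h.coe τ hτ]; exact (hn x).1
    · rw [hcoe3 τ hτ]; exact (hn x).2
  · exact decayNorm_le ((h.mono hp hq).fourierDecay_growthBound
      (fun τ hτ => (fourierDecay_decayNorm _).mono (hM τ hτ)) (by linarith) hσ hτ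
      ((fourierDecay_decayNorm _).mono hm))

theorem exists_isFlowOn {T : ℝ} {u : ℝ → Plane → ℂ} (hu : IsNLSSolution 2 T u) :
    ∃ S, IsFlowOn 0 T u S := by
  obtain ⟨hs, hS, heq⟩ := hu
  choose! S hS using hS
  refine ⟨S, hs, fun τ hτ x => by rw [hS τ hτ], fun τ hτ x => ?_⟩
  have h := heq τ hτ x
  rw [(hasDerivAt_dt hs τ x).deriv] at h
  rw [rhsS_apply, coe_lapS, cubicS_apply, hS τ hτ]
  have hI : I * I = -1 := Complex.I_mul_I
  push_cast
  linear_combination (-I) * h + (dt u τ x) * hI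

section Multiplier

/-- The symbol of `I`, as a function of `|ξ|²`. -/
def symb (φ : ℝ → ℝ) (ρ : ℝ) : ℝ := if ρ ≤ 0 then 1 else φ √ρ

variable {s N : ℝ} {Ck : ℕ → ℝ} {φ : ℝ → ℝ}

theorem symb_eq_one (hN : 1 ≤ N) (h : IMultiplier s N Ck φ) {ρ : ℝ} (hρ : ρ < 1) :
    symb φ ρ = 1 := by
  unfold symb
  split_ifs with h0
  · rfl
  · push Not at h0
    exact h.eq_one _ (Real.sqrt_pos.2 h0) ((Real.sqrt_le_one.2 hρ.le).trans hN)

theorem symb_eq_rpow (hN : 1 ≤ N) (h : IMultiplier s N Ck φ) {ρ : ℝ} (hρ : 4 * N ^ 2 ≤ ρ) :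
    symb φ ρ = (N ^ (s - 1))⁻¹ * ρ ^ ((s - 1) / 2) := by
  have hN2 : 0 < N ^ 2 := by positivity
  have hρ0 : 0 < ρ := by linarith
  rw [symb, if_neg (not_le.2 hρ0), h.eq_pow _ (Real.le_sqrt_of_sq_le (by linarith)),
    Real.div_rpow (Real.sqrt_nonneg _) (by linarith), Real.sqrt_eq_rpow, ← Real.rpow_mul hρ0.le,
    div_eq_inv_mul]
  congr 2
  ring

theorem symb_nonneg (h : IMultiplier s N Ck φ) (ρ : ℝ) : 0 ≤ symb φ ρ := by
  unfold symb
  split_ifs with h0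
  · exact zero_le_one
  · exact (h.pos _ (Real.sqrt_pos.2 (not_le.1 h0))).le

theorem symb_le_one (h : IMultiplier s N Ck φ) (ρ : ℝ) : symb φ ρ ≤ 1 := by
  unfold symb
  split_ifs with h0
  · exact le_rfl
  · exact h.le_one _ (Real.sqrt_pos.2 (not_le.1 h0))

theorem contDiff_symb (hN : 1 ≤ N) (h : IMultiplier s N Ck φ) : ContDiff ℝ ∞ (symb φ) := by
  rw [contDiff_iff_contDiffAt]
  intro ρ
  rcases lt_or_ge ρ 1 with hρ | hρ
  · refine (contDiffAt_const (c := (1 : ℝ))).congr_of_eventuallyEq ?_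
    filter_upwards [Iio_mem_nhds hρ] with z hz using symb_eq_one hN h hz
  · have hρ0 : 0 < ρ := by linarith
    have h1 : ContDiffAt ℝ ∞ φ √ρ :=
      h.contDiff.contDiffAt (Ioi_mem_nhds (Real.sqrt_pos.2 hρ0))
    refine (h1.comp ρ (Real.contDiffAt_sqrt hρ0.ne')).congr_of_eventuallyEq ?_
    filter_upwards [Ioi_mem_nhds hρ0] with z hz
    rw [symb, if_neg (not_le.2 hz), Function.comp_apply]

theorem hasTemperateGrowth_symb (hs : s < 1) (hN : 1 ≤ N) (h : IMultiplier s N Ck φ) :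
    (symb φ).HasTemperateGrowth := by
  refine ⟨contDiff_symb hN h, fun n => ?_⟩
  have hc : Continuous fun ρ => ‖iteratedFDeriv ℝ n (symb φ) ρ‖ :=
    ((contDiff_symb hN h).continuous_iteratedFDeriv (mod_cast le_top)).norm
  obtain ⟨B, hB⟩ := (isCompact_Icc (a := (0 : ℝ)) (b := 4 * N ^ 2)).bddAbove_image hc.continuousOn
  refine ⟨0, max (max B 1) (|(N ^ (s - 1))⁻¹| * |Polynomial.eval ((s - 1) / 2)
    (descPochhammer ℝ n)|), fun ρ => ?_⟩
  rw [pow_zero, mul_one]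
  rcases lt_or_ge ρ 0 with h0 | h0
  · refine le_trans ?_ ((le_max_right B 1).trans (le_max_left _ _))
    have he : symb φ =ᶠ[nhds ρ] fun _ => 1 := by
      filter_upwards [Iio_mem_nhds h0] with z hz using symb_eq_one hN h (lt_trans hz one_pos)
    rw [norm_iteratedFDeriv_eq_norm_iteratedDeriv, he.iteratedDeriv_eq, iteratedDeriv_const]
    split_ifs <;> simp
  rcases le_or_gt ρ (4 * N ^ 2) with h1 | h1
  · exact (hB ⟨ρ, ⟨h0, h1⟩, rfl⟩).trans ((le_max_left B 1).trans (le_max_left _ _))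
  · refine le_trans ?_ (le_max_right _ _)
    have hρ1 : 1 ≤ ρ := by nlinarith
    have he : symb φ =ᶠ[nhds ρ] fun ρ => (N ^ (s - 1))⁻¹ * ρ ^ ((s - 1) / 2) := by
      filter_upwards [Ioi_mem_nhds h1] with z hz using symb_eq_rpow hN h (le_of_lt hz)
    rw [norm_iteratedFDeriv_eq_norm_iteratedDeriv, he.iteratedDeriv_eq,
      iteratedDeriv_const_mul_field, iteratedDeriv_eq_iterate, Real.iter_deriv_rpow_const,
      norm_mul, norm_mul, Real.norm_eq_abs, Real.norm_eq_abs]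
    have h2 : ‖ρ ^ ((s - 1) / 2 - n)‖ ≤ 1 := by
      rw [Real.norm_of_nonneg (by positivity)]
      exact Real.rpow_le_one_of_one_le_of_nonpos hρ1 (by
        have : (0 : ℝ) ≤ n := n.cast_nonneg
        linarith)
    exact mul_le_mul_of_nonneg_left (mul_le_of_le_one_right (abs_nonneg _) h2) (abs_nonneg _)

theorem hasTemperateGrowth_symb_norm_sq (hs : s < 1) (hN : 1 ≤ N) (h : IMultiplier s N Ck φ) :
    (fun ξ : Plane => (symb φ (‖ξ‖ ^ 2) : ℂ)).HasTemperateGrowth :=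
  Function.Complex.hasTemperateGrowth_ofReal.comp ((hasTemperateGrowth_symb hs hN h).comp
    (Function.hasTemperateGrowth_norm_sq Plane))

/-- The smoothing operator `I` on Schwartz functions. -/
def smoothS (φ : ℝ → ℝ) (f : 𝓢(Plane, ℂ)) : 𝓢(Plane, ℂ) :=
  𝓕⁻ (smulLeftCLM ℂ (fun ξ : Plane => (symb φ (‖ξ‖ ^ 2) : ℂ)) (𝓕 f))

theorem fourier_smoothS (hs : s < 1) (hN : 1 ≤ N) (h : IMultiplier s N Ck φ)
    (f : 𝓢(Plane, ℂ)) (ξ : Plane) :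
    𝓕 (smoothS φ f : Plane → ℂ) ξ = symb φ (‖ξ‖ ^ 2) * 𝓕 (f : Plane → ℂ) ξ := by
  rw [← fourier_coe, smoothS, FourierTransform.fourier_fourierInv_eq,
    smulLeftCLM_apply_apply (hasTemperateGrowth_symb_norm_sq hs hN h), smul_eq_mul, fourier_coe]

theorem coe_smoothS (hs : s < 1) (hN : 1 ≤ N) (h : IMultiplier s N Ck φ)
    (f : 𝓢(Plane, ℂ)) : ⇑(smoothS φ f) = Iop φ (f : Plane → ℂ) := by
  have h1 : ⇑(smoothS φ f) = 𝓕⁻ (𝓕 (smoothS φ f : Plane → ℂ)) := by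
    rw [← fourier_coe, ← fourierInv_coe]; simp
  rw [h1]
  ext x
  simp only [Iop, fourierMult, Real.fourierInv_eq, fourier_smoothS hs hN h]
  refine integral_congr_ae ?_
  have h0 : ∀ᵐ ξ : Plane, ξ ≠ 0 := by simp [ae_iff, measure_singleton]
  filter_upwards [h0] with ξ hξ
  have hξ' : 0 < ‖ξ‖ := norm_pos_iff.2 hξ
  have h2 : symb φ (‖ξ‖ ^ 2) = φ ‖ξ‖ := by
    rw [symb, if_neg (not_le.2 (by positivity)), Real.sqrt_sq hξ'.le]
  rw [h2]

theorem fourierDecay_smoothS (hs : s < 1) (hN : 1 ≤ N) (h : IMultiplier s N Ck φ) {M : ℝ}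
    {f : 𝓢(Plane, ℂ)} (hf : FourierDecay M f) : FourierDecay M (smoothS φ f) := fun ξ => by
  refine le_trans (mul_le_mul_of_nonneg_left ?_ (by positivity)) (hf ξ)
  rw [fourier_smoothS hs hN h, norm_mul, Complex.norm_real,
    Real.norm_of_nonneg (symb_nonneg h _)]
  exact mul_le_of_le_one_left (norm_nonneg _) (symb_le_one h _)

/-- The commutator of `I` with the cubic nonlinearity, on Schwartz functions. -/
def commS (φ : ℝ → ℝ) (f : 𝓢(Plane, ℂ)) : 𝓢(Plane, ℂ) :=
  smoothS φ (cubicS f) - cubicS (smoothS φ f)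

theorem coe_commS (hs : s < 1) (hN : 1 ≤ N) (h : IMultiplier s N Ck φ)
    {u : ℝ → Plane → ℂ} {τ : ℝ} {f : 𝓢(Plane, ℂ)} (hf : ⇑f = u τ) :
    ⇑(commS φ f) = Wcomm φ u τ := by
  ext x
  have h1 : ⇑(cubicS f) = cubicN u τ := by
    ext x; rw [cubicS_apply, hf, cubicN]
  rw [commS, sub_apply, cubicS_apply, coe_smoothS hs hN h, coe_smoothS hs hN h, h1, hf, Wcomm]

theorem fourier_sub_apply (f g : 𝓢(Plane, ℂ)) (ξ : Plane) :
    𝓕 (f - g : 𝓢(Plane, ℂ)) ξ = 𝓕 (f : Plane → ℂ) ξ - 𝓕 (g : Plane → ℂ) ξ := by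
  have h : 𝓕 (f - g) = 𝓕 f - 𝓕 g := by
    rw [sub_eq_add_neg, FourierTransform.fourier_add, FourierTransform.fourier_neg,
      ← sub_eq_add_neg]
  rw [h, sub_apply, fourier_coe, fourier_coe]

theorem fourier_commS (f : 𝓢(Plane, ℂ)) (ξ : Plane) :
    𝓕 (commS φ f : Plane → ℂ) ξ = 𝓕 (smoothS φ (cubicS f) : Plane → ℂ) ξ
      - 𝓕 (cubicS (smoothS φ f) : Plane → ℂ) ξ := by
  rw [← fourier_coe, commS, fourier_sub_apply]

theorem fourierDecay_cubicS_uniform {M : ℝ} {f : 𝓢(Plane, ℂ)} (hf : FourierDecay M f) :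
    FourierDecay (2080 * (M * weightIntegral) ^ 2 * M) (cubicS f) := by
  refine (fourierDecay_cubicS hf).mono ?_
  have h1 := wienerNorm_nonneg f
  have h2 := wienerNorm_le_of_decay hf
  have h3 := hf.nonneg
  gcongr

theorem fourierDecay_commS (hs : s < 1) (hN : 1 ≤ N) (h : IMultiplier s N Ck φ) {M : ℝ}
    {f : 𝓢(Plane, ℂ)} (hf : FourierDecay M f) :
    FourierDecay (2 * (2080 * (M * weightIntegral) ^ 2 * M)) (commS φ f) := fun ξ => by
  have h1 := fourierDecay_smoothS hs hN h (fourierDecay_cubicS_uniform hf) ξ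
  have h2 := fourierDecay_cubicS_uniform (fourierDecay_smoothS hs hN h hf) ξ
  rw [fourier_commS]
  refine (mul_le_mul_of_nonneg_left (norm_sub_le _ _) (by positivity)).trans ?_
  rw [mul_add]
  linarith

theorem continuousOn_fourier_smoothS (hs : s < 1) (hN : 1 ≤ N) (h : IMultiplier s N Ck φ)
    {A : Set ℝ} {f : ℝ → 𝓢(Plane, ℂ)}
    (hfc : ∀ ξ, ContinuousOn (fun τ => 𝓕 (f τ : Plane → ℂ) ξ) A) (ξ : Plane) :
    ContinuousOn (fun τ => 𝓕 (smoothS φ (f τ) : Plane → ℂ) ξ) A := by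
  simp only [fourier_smoothS hs hN h]
  exact continuousOn_const.mul (hfc ξ)

theorem continuousOn_fourier_commS (hs : s < 1) (hN : 1 ≤ N) (h : IMultiplier s N Ck φ)
    {A : Set ℝ} {M : ℝ} {f : ℝ → 𝓢(Plane, ℂ)} (hf : ∀ τ ∈ A, FourierDecay M (f τ))
    (hfc : ∀ ξ, ContinuousOn (fun τ => 𝓕 (f τ : Plane → ℂ) ξ) A) (ξ : Plane) :
    ContinuousOn (fun τ => 𝓕 (commS φ (f τ) : Plane → ℂ) ξ) A := by
  simp only [fourier_commS]
  exact (continuousOn_fourier_smoothS hs hN h (continuousOn_fourier_cubicS hf hfc) ξ).sub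
    (continuousOn_fourier_cubicS (fun τ hτ => fourierDecay_smoothS hs hN h (hf τ hτ))
      (continuousOn_fourier_smoothS hs hN h hfc) ξ)

end Multiplier

section Norms

variable {A : Set ℝ} {M : ℝ} {f : ℝ → 𝓢(Plane, ℂ)}

theorem FourierDecay.norm_sq_le {f : Plane → ℂ} (h : FourierDecay M f) (ξ : Plane) :
    ‖𝓕 f ξ‖ ^ 2 ≤ M ^ 2 * ((1 + ‖ξ‖) ^ 12)⁻¹ := by
  calc ‖𝓕 f ξ‖ ^ 2 ≤ (M * ((1 + ‖ξ‖) ^ 6)⁻¹) ^ 2 := by gcongr; exact h.norm_le ξ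
    _ = _ := by rw [mul_pow, inv_pow, ← pow_mul]

theorem continuousOn_L2Norm (hf : ∀ τ ∈ A, FourierDecay M (f τ))
    (hfc : ∀ ξ, ContinuousOn (fun τ => 𝓕 (f τ : Plane → ℂ) ξ) A) :
    ContinuousOn (fun τ => L2Norm (f τ : Plane → ℂ)) A := by
  simp only [L2Norm_eq]
  refine ContinuousOn.rpow_const ?_ fun _ _ => Or.inr (by norm_num)
  refine continuousOn_of_dominated (bound := fun ξ => M ^ 2 * ((1 + ‖ξ‖) ^ 12)⁻¹)
    (fun τ _ => ((f τ).fourier_continuous.norm.pow 2).aestronglyMeasurable)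
    (fun τ hτ => Filter.Eventually.of_forall fun ξ => ?_)
    ((integrable_inv_one_add_norm_pow (by norm_num)).const_mul _)
    (Filter.Eventually.of_forall fun ξ => (hfc ξ).norm.pow 2)
  rw [Real.norm_of_nonneg (by positivity)]
  exact FourierDecay.norm_sq_le (hf τ hτ) ξ

theorem continuousOn_gradL2Norm (hf : ∀ τ ∈ A, FourierDecay M (f τ))
    (hfc : ∀ ξ, ContinuousOn (fun τ => 𝓕 (f τ : Plane → ℂ) ξ) A) :
    ContinuousOn (fun τ => gradL2Norm (f τ : Plane → ℂ)) A := by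
  simp only [gradL2Norm_eq]
  refine ContinuousOn.rpow_const ?_ fun _ _ => Or.inr (by norm_num)
  refine continuousOn_of_dominated
    (bound := fun ξ => 4 * π ^ 2 * M ^ 2 * ((1 + ‖ξ‖) ^ 10)⁻¹)
    (fun τ _ => ((continuous_const.mul (continuous_norm.pow 2)).mul
      ((f τ).fourier_continuous.norm.pow 2)).aestronglyMeasurable)
    (fun τ hτ => Filter.Eventually.of_forall fun ξ => ?_)
    ((integrable_inv_one_add_norm_pow (by norm_num)).const_mul _)
    (Filter.Eventually.of_forall fun ξ => continuousOn_const.mul ((hfc ξ).norm.pow 2))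
  rw [Real.norm_of_nonneg (by positivity)]
  have h1 := FourierDecay.norm_sq_le (hf τ hτ) ξ
  have h2 : ‖ξ‖ ^ 2 ≤ (1 + ‖ξ‖) ^ 2 := by gcongr; linarith
  calc 4 * π ^ 2 * ‖ξ‖ ^ 2 * ‖𝓕 (f τ : Plane → ℂ) ξ‖ ^ 2
      ≤ 4 * π ^ 2 * (1 + ‖ξ‖) ^ 2 * (M ^ 2 * ((1 + ‖ξ‖) ^ 12)⁻¹) := by gcongr
    _ = _ := by field_simp

end Norms

section Spatial

theorem L2Norm_nonneg (f : Plane → ℂ) : 0 ≤ L2Norm f :=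
  Real.rpow_nonneg (integral_nonneg fun _ => by positivity) _

theorem gradL2Norm_nonneg (f : Plane → ℂ) : 0 ≤ gradL2Norm f :=
  Real.rpow_nonneg (integral_nonneg fun _ => by positivity) _

theorem integrable_norm_mul_norm (f g : 𝓢(Plane, ℂ)) : Integrable fun x => ‖f x‖ * ‖g x‖ := by
  refine (mulS f g).integrable.norm.congr (Filter.Eventually.of_forall fun x => ?_)
  simp only [mulS_apply, norm_mul]

theorem integral_norm_mul_norm_le (f g : 𝓢(Plane, ℂ)) :
    ∫ x, ‖f x‖ * ‖g x‖ ≤ L2Norm (f : Plane → ℂ) * L2Norm (g : Plane → ℂ) := by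
  have h := integral_mul_le_Lp_mul_Lq_of_nonneg (μ := (volume : Measure Plane))
    Real.HolderConjugate.two_two (f := fun x => ‖f x‖) (g := fun x => ‖g x‖)
    (Filter.Eventually.of_forall fun _ => norm_nonneg _)
    (Filter.Eventually.of_forall fun _ => norm_nonneg _)
    (by simpa using (f.memLp 2).norm) (by simpa using (g.memLp 2).norm)
  simp only [Real.rpow_two] at h
  exact h

theorem L2Norm_pdS_le (j : Fin 2) (f : 𝓢(Plane, ℂ)) :
    L2Norm (pdS j f : Plane → ℂ) ≤ gradL2Norm (f : Plane → ℂ) := by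
  unfold L2Norm gradL2Norm
  refine Real.rpow_le_rpow (integral_nonneg fun _ => by positivity) ?_ (by norm_num)
  simp only [← coe_pdS]
  refine integral_mono (integrable_norm_sq _)
    (integrable_finsetSum _ fun i _ => integrable_norm_sq _) fun x => ?_
  exact Finset.single_le_sum (f := fun i => ‖pdS i f x‖ ^ 2) (fun _ _ => by positivity)
    (Finset.mem_univ j)

/-- A pointwise majorant for one directional component of the error density. -/
def errMajorant (w v : 𝓢(Plane, ℂ)) (j : Fin 2) (x y : Plane) : ℝ :=
  (‖w x‖ * ‖pdS j v x‖) * (‖v y‖ * ‖v y‖)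
    + 2 * ((‖v x‖ * ‖pdS j v x‖) * (‖w y‖ * ‖v y‖))
    + (‖v x‖ * ‖pdS j w x‖) * (‖v y‖ * ‖v y‖)

theorem integrable_norm_mul_prod (f g h k : 𝓢(Plane, ℂ)) :
    Integrable fun p : Plane × Plane => (‖f p.1‖ * ‖g p.1‖) * (‖h p.2‖ * ‖k p.2‖) :=
  (integrable_norm_mul_norm f g).mul_prod (integrable_norm_mul_norm h k)

theorem integral_norm_mul_prod_le (f g h k : 𝓢(Plane, ℂ)) :
    ∫ p : Plane × Plane, (‖f p.1‖ * ‖g p.1‖) * (‖h p.2‖ * ‖k p.2‖)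
      ≤ (L2Norm (f : Plane → ℂ) * L2Norm (g : Plane → ℂ))
        * (L2Norm (h : Plane → ℂ) * L2Norm (k : Plane → ℂ)) := by
  have e : ∫ p : Plane × Plane, (‖f p.1‖ * ‖g p.1‖) * (‖h p.2‖ * ‖k p.2‖)
      = (∫ x, ‖f x‖ * ‖g x‖) * ∫ y, ‖h y‖ * ‖k y‖ :=
    integral_prod_mul (fun x => ‖f x‖ * ‖g x‖) fun y => ‖h y‖ * ‖k y‖
  rw [e]
  exact mul_le_mul (integral_norm_mul_norm_le f g) (integral_norm_mul_norm_le h k)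
    (integral_nonneg fun _ => by positivity) (mul_nonneg (L2Norm_nonneg _) (L2Norm_nonneg _))

theorem integrable_errMajorant (w v : 𝓢(Plane, ℂ)) (j : Fin 2) :
    Integrable fun p : Plane × Plane => errMajorant w v j p.1 p.2 :=
  ((integrable_norm_mul_prod w (pdS j v) v v).add
    ((integrable_norm_mul_prod v (pdS j v) w v).const_mul 2)).add
    (integrable_norm_mul_prod v (pdS j w) v v)

/-- The bound for the error term at a fixed time. -/
def errBound (w v : Plane → ℂ) : ℝ :=
  (L2Norm w * gradL2Norm v + gradL2Norm w * L2Norm v) * L2Norm v ^ 2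

theorem integral_errMajorant_le (w v : 𝓢(Plane, ℂ)) (j : Fin 2) :
    ∫ p : Plane × Plane, errMajorant w v j p.1 p.2 ≤ 3 * errBound w v := by
  have i1 := integrable_norm_mul_prod w (pdS j v) v v
  have i2 := (integrable_norm_mul_prod v (pdS j v) w v).const_mul 2
  have i3 := integrable_norm_mul_prod v (pdS j w) v v
  have h1 := integral_norm_mul_prod_le w (pdS j v) v v
  have h2 := integral_norm_mul_prod_le v (pdS j v) w v
  have h3 := integral_norm_mul_prod_le v (pdS j w) v v
  have i12 : Integrable fun p : Plane × Plane => (‖w p.1‖ * ‖pdS j v p.1‖) * (‖v p.2‖ * ‖v p.2‖)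
      + 2 * ((‖v p.1‖ * ‖pdS j v p.1‖) * (‖w p.2‖ * ‖v p.2‖)) := i1.add i2
  unfold errMajorant
  rw [integral_add i12 i3, integral_add i1 i2, integral_const_mul]
  have hv := L2Norm_nonneg v
  have hw := L2Norm_nonneg w
  have hgw := gradL2Norm_nonneg w
  have p1 := L2Norm_pdS_le j v
  have p2 := L2Norm_pdS_le j w
  have q1 := mul_le_mul_of_nonneg_left p1
    (mul_nonneg hw (mul_nonneg hv hv))
  have q2 := mul_le_mul_of_nonneg_left p2
    (mul_nonneg hv (mul_nonneg hv hv))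
  have q3 : 0 ≤ gradL2Norm (w : Plane → ℂ) * L2Norm (v : Plane → ℂ) ^ 3 := by positivity
  unfold errBound
  nlinarith

theorem hasFDerivAt_coe_fst (f : 𝓢(Plane, ℂ)) (p : Plane × Plane) :
    HasFDerivAt (fun p : Plane × Plane => f p.1)
      ((fderiv ℝ f p.1).comp (ContinuousLinearMap.fst ℝ Plane Plane)) p :=
  (f.differentiableAt.hasFDerivAt).comp p hasFDerivAt_fst

theorem hasFDerivAt_coe_snd (f : 𝓢(Plane, ℂ)) (p : Plane × Plane) :
    HasFDerivAt (fun p : Plane × Plane => f p.2)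
      ((fderiv ℝ f p.2).comp (ContinuousLinearMap.snd ℝ Plane Plane)) p :=
  (f.differentiableAt.hasFDerivAt).comp p hasFDerivAt_snd

theorem fderiv_tensor (f g : 𝓢(Plane, ℂ)) (p q : Plane × Plane) :
    fderiv ℝ (fun p : Plane × Plane => f p.1 * g p.2) p q
      = f p.1 * fderiv ℝ g p.2 q.2 + g p.2 * fderiv ℝ f p.1 q.1 := by
  rw [((hasFDerivAt_coe_fst f p).fun_mul (hasFDerivAt_coe_snd g p)).fderiv]
  simp

theorem differentiableAt_tensor (f g : 𝓢(Plane, ℂ)) (p : Plane × Plane) :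
    DifferentiableAt ℝ (fun p : Plane × Plane => f p.1 * g p.2) p :=
  ((hasFDerivAt_coe_fst f p).mul (hasFDerivAt_coe_snd g p)).differentiableAt

theorem pdS_apply (j : Fin 2) (f : 𝓢(Plane, ℂ)) (x : Plane) :
    pdS j f x = fderiv ℝ f x (EuclideanSpace.single j 1) := by
  rw [coe_pdS, pd]

theorem abs_re_bracket_le (F G F' G' : ℂ) :
    |(F * (starRingEnd ℂ) G' - G * (starRingEnd ℂ) F').re| ≤ ‖F‖ * ‖G'‖ + ‖G‖ * ‖F'‖ := by
  refine (Complex.abs_re_le_norm _).trans ((norm_sub_le _ _).trans ?_)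
  simp only [norm_mul, RCLike.norm_conj, le_refl]

variable {φ : ℝ → ℝ} {u : ℝ → Plane → ℂ} {τ : ℝ} {w v : 𝓢(Plane, ℂ)}

theorem abs_bracketDir_fst_le (hw : ⇑w = Wcomm φ u τ) (hv : ⇑v = Iop φ (u τ))
    (p : Plane × Plane) (j : Fin 2) :
    |bracketDir (Nbad φ u τ) (tensIu φ u τ) p (EuclideanSpace.single j 1, 0)|
      ≤ errMajorant w v j p.1 p.2 := by
  have hN : Nbad φ u τ = fun p => w p.1 * v p.2 + v p.1 * w p.2 := by
    ext p; rw [Nbad, ← hw, ← hv]; ring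
  have hT : tensIu φ u τ = fun p => v p.1 * v p.2 := by ext p; rw [tensIu, ← hv]
  have d1 : fderiv ℝ (Nbad φ u τ) p (EuclideanSpace.single j 1, 0)
      = v p.2 * pdS j w p.1 + w p.2 * pdS j v p.1 := by
    rw [hN, fderiv_fun_add (differentiableAt_tensor w v p) (differentiableAt_tensor v w p)]
    simp [fderiv_tensor, pdS_apply]
  have d2 : fderiv ℝ (tensIu φ u τ) p (EuclideanSpace.single j 1, 0) = v p.2 * pdS j v p.1 := by
    rw [hT, fderiv_tensor]; simp [pdS_apply]
  unfold bracketDir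
  rw [d1, d2, hN, hT]
  refine (abs_re_bracket_le _ _ _ _).trans ?_
  have n1 := norm_add_le (w p.1 * v p.2) (v p.1 * w p.2)
  have n2 := norm_add_le (v p.2 * pdS j w p.1) (w p.2 * pdS j v p.1)
  refine (add_le_add (mul_le_mul_of_nonneg_right n1 (norm_nonneg _))
    (mul_le_mul_of_nonneg_left n2 (norm_nonneg _))).trans (le_of_eq ?_)
  simp only [norm_mul, errMajorant]
  ring

theorem abs_bracketDir_snd_le (hw : ⇑w = Wcomm φ u τ) (hv : ⇑v = Iop φ (u τ))
    (p : Plane × Plane) (j : Fin 2) :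
    |bracketDir (Nbad φ u τ) (tensIu φ u τ) p (0, EuclideanSpace.single j 1)|
      ≤ errMajorant w v j p.2 p.1 := by
  have hN : Nbad φ u τ = fun p => w p.1 * v p.2 + v p.1 * w p.2 := by
    ext p; rw [Nbad, ← hw, ← hv]; ring
  have hT : tensIu φ u τ = fun p => v p.1 * v p.2 := by ext p; rw [tensIu, ← hv]
  have d1 : fderiv ℝ (Nbad φ u τ) p (0, EuclideanSpace.single j 1)
      = w p.1 * pdS j v p.2 + v p.1 * pdS j w p.2 := by
    rw [hN, fderiv_fun_add (differentiableAt_tensor w v p) (differentiableAt_tensor v w p)]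
    simp [fderiv_tensor, pdS_apply]
  have d2 : fderiv ℝ (tensIu φ u τ) p (0, EuclideanSpace.single j 1) = v p.1 * pdS j v p.2 := by
    rw [hT, fderiv_tensor]; simp [pdS_apply]
  unfold bracketDir
  rw [d1, d2, hN, hT]
  refine (abs_re_bracket_le _ _ _ _).trans ?_
  have n1 := norm_add_le (w p.1 * v p.2) (v p.1 * w p.2)
  have n2 := norm_add_le (w p.1 * pdS j v p.2) (v p.1 * pdS j w p.2)
  refine (add_le_add (mul_le_mul_of_nonneg_right n1 (norm_nonneg _))
    (mul_le_mul_of_nonneg_left n2 (norm_nonneg _))).trans (le_of_eq ?_)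
  simp only [norm_mul, errMajorant]
  ring

theorem abs_integral_errDensity_le (hw : ⇑w = Wcomm φ u τ) (hv : ⇑v = Iop φ (u τ)) {A : ℝ}
    {a : Plane × Plane → ℝ} (ha : ∀ p, ‖fderiv ℝ a p‖ ≤ A) :
    |∫ p, errDensity a φ u τ p| ≤ 12 * A * errBound w v := by
  have hA : 0 ≤ A := (norm_nonneg _).trans (ha 0)
  have i1 : ∀ j, Integrable fun p : Plane × Plane => A * errMajorant w v j p.1 p.2 :=
    fun j => (integrable_errMajorant w v j).const_mul A
  have i2 : ∀ j, Integrable fun p : Plane × Plane => A * errMajorant w v j p.2 p.1 :=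
    fun j => (integrable_errMajorant w v j).swap.const_mul A
  have e2 : ∀ j, ∫ p : Plane × Plane, errMajorant w v j p.2 p.1
      = ∫ p : Plane × Plane, errMajorant w v j p.1 p.2 := fun j =>
    integral_prod_swap fun p : Plane × Plane => errMajorant w v j p.1 p.2
  have hdir : ∀ (p q : Plane × Plane) (b : ℝ), ‖q‖ ≤ 1 → ∀ {m : ℝ}, |b| ≤ m →
      |fderiv ℝ a p q * b| ≤ A * m := fun p q b hq m hb => by
    rw [abs_mul]
    refine mul_le_mul ?_ hb (abs_nonneg _) hA
    calc |fderiv ℝ a p q| ≤ ‖fderiv ℝ a p‖ * ‖q‖ := (fderiv ℝ a p).le_opNorm q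
      _ ≤ A * 1 := mul_le_mul (ha p) hq (norm_nonneg _) hA
      _ = A := mul_one A
  have hbound : ∀ p : Plane × Plane, ‖errDensity a φ u τ p‖
      ≤ (∑ j, A * errMajorant w v j p.1 p.2) + ∑ j, A * errMajorant w v j p.2 p.1 := fun p => by
    rw [errDensity, Real.norm_eq_abs]
    refine (abs_add_le _ _).trans (add_le_add ?_ ?_)
    · refine (Finset.abs_sum_le_sum_abs _ _).trans (Finset.sum_le_sum fun j _ => ?_)
      exact hdir p _ _ (by simp [Prod.norm_def]) (abs_bracketDir_fst_le hw hv p j)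
    · refine (Finset.abs_sum_le_sum_abs _ _).trans (Finset.sum_le_sum fun j _ => ?_)
      exact hdir p _ _ (by simp [Prod.norm_def]) (abs_bracketDir_snd_le hw hv p j)
  have s1 := integrable_finsetSum (μ := (volume : Measure (Plane × Plane))) Finset.univ
    fun j _ => i1 j
  have s2 := integrable_finsetSum (μ := (volume : Measure (Plane × Plane))) Finset.univ
    fun j _ => i2 j
  refine (norm_integral_le_of_norm_le (s1.add s2) (Filter.Eventually.of_forall hbound)).trans ?_
  rw [integral_add' s1 s2, integral_finsetSum _ fun j _ => i1 j,
    integral_finsetSum _ fun j _ => i2 j]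
  simp only [integral_const_mul, e2, Fin.sum_univ_two]
  have k0 := mul_le_mul_of_nonneg_left (integral_errMajorant_le w v 0) hA
  have k1 := mul_le_mul_of_nonneg_left (integral_errMajorant_le w v 1) hA
  linarith

end Spatial

theorem le_biSup_Icc {a b : ℝ} {f : ℝ → ℝ} (hf : ContinuousOn f (Set.Icc a b)) {τ : ℝ}
    (hτ : τ ∈ Set.Icc a b) : f τ ≤ ⨆ t ∈ Set.Icc a b, f t := by
  obtain ⟨B, hB⟩ := isCompact_Icc.bddAbove_image hf
  have hbdd : BddAbove (Set.range fun t => ⨆ _ : t ∈ Set.Icc a b, f t) := by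
    refine ⟨max B 0, ?_⟩
    rintro _ ⟨t, rfl⟩
    by_cases ht : t ∈ Set.Icc a b
    · simp only [ciSup_pos ht]
      exact (hB ⟨t, ht, rfl⟩).trans (le_max_left _ _)
    · have : IsEmpty (t ∈ Set.Icc a b) := ⟨ht⟩
      simp only [Real.iSup_of_isEmpty, le_max_right]
  refine le_ciSup_of_le hbdd τ ?_
  rw [ciSup_pos hτ]

end SchwartzMap

/-- The error term in the almost Morawetz estimate is controlled by mixed
space-time norms of the commutator `W` and of `I_N u`. -/
theorem almost_morawetz_error_bound :
    ∃ C > (0:ℝ), ∀ T > (0:ℝ), ∀ u : ℝ → EuclideanSpace ℝ (Fin 2) → ℂ, IsNLSSolution 2 T u →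
      ∀ s : ℝ, 0 < s → s < 1 → ∀ N : ℝ, 1 ≤ N → ∀ Ck : ℕ → ℝ, ∀ φ : ℝ → ℝ,
        IMultiplier s N Ck φ →
        ∀ A : ℝ, ∀ a : EuclideanSpace ℝ (Fin 2) × EuclideanSpace ℝ (Fin 2) → ℝ,
          ContDiff ℝ 1 a → (∀ p, ‖fderiv ℝ a p‖ ≤ A) →
          |∫ t in Set.Ioc (0:ℝ) T, ∫ p, errDensity a φ u t p|
            ≤ C * A *
              ((∫ t in Set.Ioc (0:ℝ) T, L2Norm (Wcomm φ u t)) *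
                  (⨆ t ∈ Set.Icc (0:ℝ) T, gradL2Norm (Iop φ (u t)))
                + (∫ t in Set.Ioc (0:ℝ) T, gradL2Norm (Wcomm φ u t)) *
                  (⨆ t ∈ Set.Icc (0:ℝ) T, L2Norm (Iop φ (u t))))
              * (⨆ t ∈ Set.Icc (0:ℝ) T, L2Norm (Iop φ (u t))) ^ 2 := by
  refine ⟨12, by norm_num, fun T hT u hu s _ hs N hN Ck φ hφ A a _ ha => ?_⟩
  have hA : 0 ≤ A := (norm_nonneg _).trans (ha 0)
  obtain ⟨S, hS⟩ := SchwartzMap.exists_isFlowOn hu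
  obtain ⟨M, hM⟩ := hS.exists_uniform_fourierDecay
  have hSu : ∀ τ ∈ Set.Icc 0 T, ⇑(S τ) = u τ := fun τ hτ => funext (hS.coe τ hτ)
  have hv : ∀ τ ∈ Set.Icc 0 T, ⇑(SchwartzMap.smoothS φ (S τ)) = Iop φ (u τ) := fun τ hτ => by
    rw [SchwartzMap.coe_smoothS hs hN hφ, hSu τ hτ]
  have hw : ∀ τ ∈ Set.Icc 0 T, ⇑(SchwartzMap.commS φ (S τ)) = Wcomm φ u τ := fun τ hτ =>
    SchwartzMap.coe_commS hs hN hφ (hSu τ hτ)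
  have dv := fun τ hτ => SchwartzMap.fourierDecay_smoothS hs hN hφ (hM τ hτ)
  have dw := fun τ hτ => SchwartzMap.fourierDecay_commS hs hN hφ (hM τ hτ)
  have fv := SchwartzMap.continuousOn_fourier_smoothS hs hN hφ (hS.continuousOn_fourier hM)
  have fw := SchwartzMap.continuousOn_fourier_commS hs hN hφ hM (hS.continuousOn_fourier hM)
  have cv : ContinuousOn (fun τ => L2Norm (Iop φ (u τ))) (Set.Icc 0 T) :=
    (SchwartzMap.continuousOn_L2Norm dv fv).congr fun τ hτ => by simp only [hv τ hτ]
  have cgv : ContinuousOn (fun τ => gradL2Norm (Iop φ (u τ))) (Set.Icc 0 T) :=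
    (SchwartzMap.continuousOn_gradL2Norm dv fv).congr fun τ hτ => by simp only [hv τ hτ]
  have cw : ContinuousOn (fun τ => L2Norm (Wcomm φ u τ)) (Set.Icc 0 T) :=
    (SchwartzMap.continuousOn_L2Norm dw fw).congr fun τ hτ => by simp only [hw τ hτ]
  have cgw : ContinuousOn (fun τ => gradL2Norm (Wcomm φ u τ)) (Set.Icc 0 T) :=
    (SchwartzMap.continuousOn_gradL2Norm dw fw).congr fun τ hτ => by simp only [hw τ hτ]
  have iw : IntegrableOn (fun τ => L2Norm (Wcomm φ u τ)) (Set.Ioc 0 T) :=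
    cw.integrableOn_Icc.mono_set Set.Ioc_subset_Icc_self
  have igw : IntegrableOn (fun τ => gradL2Norm (Wcomm φ u τ)) (Set.Ioc 0 T) :=
    cgw.integrableOn_Icc.mono_set Set.Ioc_subset_Icc_self
  have hsv := fun τ hτ => SchwartzMap.le_biSup_Icc cv (τ := τ) hτ
  have hsg := fun τ hτ => SchwartzMap.le_biSup_Icc cgv (τ := τ) hτ
  set V := ⨆ t ∈ Set.Icc (0:ℝ) T, L2Norm (Iop φ (u t))
  set G := ⨆ t ∈ Set.Icc (0:ℝ) T, gradL2Norm (Iop φ (u t))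
  have iwG := iw.mul_const G
  have igwV := igw.mul_const V
  have hmain := norm_integral_le_of_norm_le (((iwG.add igwV).mul_const (V ^ 2)).const_mul (12 * A))
    (f := fun t => ∫ p, errDensity a φ u t p) <| by
      refine (ae_restrict_iff' measurableSet_Ioc).2 (Filter.Eventually.of_forall fun τ hτ => ?_)
      have hτ' := Set.Ioc_subset_Icc_self hτ
      have h1 := SchwartzMap.abs_integral_errDensity_le (hw τ hτ') (hv τ hτ') ha
      rw [hw τ hτ', hv τ hτ', SchwartzMap.errBound] at h1
      have h2 := hsv τ hτ'
      have h3 := hsg τ hτ'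
      have n1 := SchwartzMap.L2Norm_nonneg (Wcomm φ u τ)
      have n2 := SchwartzMap.gradL2Norm_nonneg (Wcomm φ u τ)
      have n3 := SchwartzMap.L2Norm_nonneg (Iop φ (u τ))
      have n4 := SchwartzMap.gradL2Norm_nonneg (Iop φ (u τ))
      have n5 := n4.trans h3
      have n6 := n3.trans h2
      refine h1.trans (mul_le_mul_of_nonneg_left ?_ (by positivity))
      simp only [Pi.add_apply]
      gcongr
  rw [integral_const_mul, integral_mul_const] at hmain
  have e : ∫ t in Set.Ioc (0:ℝ) T, (((fun τ => L2Norm (Wcomm φ u τ) * G)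
      + fun τ => gradL2Norm (Wcomm φ u τ) * V) : ℝ → ℝ) t
      = (∫ t in Set.Ioc (0:ℝ) T, L2Norm (Wcomm φ u t)) * G
        + (∫ t in Set.Ioc (0:ℝ) T, gradL2Norm (Wcomm φ u t)) * V := by
    rw [integral_add' iwG igwV, integral_mul_const, integral_mul_const]
  rw [e, ← mul_assoc, Real.norm_eq_abs] at hmain
  exact hmain

end
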